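/- arXiv:1705.08195 — 10 statements merged into one kernel-verified Lean document; each statement's English description precedes it below -/
import Mathlib

section
/- Let p be a prime number, n > 0 an integer, and C an abelian group. Assume that for each 0 < k ≤ n there is an exact sequence S_k of ℤ/p^k-modules 0 → A_k → B_k → C[p^k] → 0 (in particular B_k is p^k-torsion), together with, for each 0 < k < n, a morphism of short exact sequences from S_k to S_{k+1} (maps A_k → A_{k+1}, B_k → B_{k+1}, C[p^k] → C[p^{k+1}] forming commutative squares) in which the right-hand vertical map is the canonical inclusion C[p^k] ↪ C[p^{k+1}]. Then the exact sequence S_n splits: the surjection B_n → C[p^n] admits a group-homomorphism section. -/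
/-- The `m`-torsion subgroup `M[m]` of an abelian group `M`. -/
def torsionSubgroup (m : ℕ) (M : Type*) [AddCommGroup M] : AddSubgroup M where
  carrier := {x | m • x = 0}
  zero_mem' := smul_zero m
  add_mem' := by
    intro a b ha hb
    simp only [Set.mem_setOf_eq] at *
    rw [smul_add, ha, hb, add_zero]
  neg_mem' := by
    intro a ha
    simp only [Set.mem_setOf_eq] at *
    rw [smul_neg, ha, neg_zero]

/-- An injective additive map between groups killed by a prime `p` has an additive retraction. -/
theorem AddMonoidHom.exists_retraction_of_injective {p : ℕ} [Fact p.Prime] {K Q : Type*}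
    [AddCommGroup K] [AddCommGroup Q] (hK : ∀ x : K, p • x = 0) (hQ : ∀ x : Q, p • x = 0)
    (i : K →+ Q) (hi : Function.Injective i) : ∃ r : Q →+ K, ∀ x, r (i x) = x := by
  let : Module (ZMod p) K := AddCommGroup.zmodModule hK
  let : Module (ZMod p) Q := AddCommGroup.zmodModule hQ
  obtain ⟨r, hr⟩ := (i.toZModLinearMap p).exists_leftInverse_of_injective
    (LinearMap.ker_eq_bot.mpr hi)
  exact ⟨r.toAddMonoidHom, fun x => LinearMap.congr_fun hr x⟩

/-- A surjection with a retraction onto its kernel has a section. -/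
theorem AddMonoidHom.exists_section_of_retraction {X T : Type*} [AddCommGroup X] [AddCommGroup T]
    (g : X →+ T) (hg : Function.Surjective g) (r : X →+ X) (hr : ∀ x, g (r x) = 0)
    (hrg : ∀ x, g x = 0 → r x = x) : ∃ s : T →+ X, ∀ t, g (s t) = t := by
  choose l hl using hg
  refine ⟨AddMonoidHom.mk' (fun t => l t - r (l t)) fun a b => ?_, fun t => ?_⟩
  · have h := hrg (l (a + b) - l a - l b) (by simp [hl])
    simp only [map_sub] at h
    rw [← sub_eq_zero] at h ⊢
    rw [← neg_eq_zero, ← h]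
    abel
  · simp [hl, hr]

/-- A section defined over `p T` with values in `B` extends to `T` if every element of `T` has
a lift to `B` compatible with it. -/
theorem AddMonoidHom.exists_section_of_section_on_multiples {p : ℕ} [Fact p.Prime] {B T : Type*}
    [AddCommGroup B] [AddCommGroup T] (g : B →+ T)
    (s : (nsmulAddMonoidHom (α := T) p).range →+ B) (hs : ∀ c, g (s c) = c)
    (hlift : ∀ t : T, ∃ b : B, g b = t ∧ p • b = s ⟨p • t, t, rfl⟩) :
    ∃ s : T →+ B, ∀ t, g (s t) = t := by
  let m : T →+ (nsmulAddMonoidHom (α := T) p).range := (nsmulAddMonoidHom (α := T) p).rangeRestrict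
  have hm : ∀ c : (nsmulAddMonoidHom (α := T) p).range, m c = p • c := fun c => rfl
  let X : AddSubgroup B := (nsmulAddMonoidHom p - s.comp (m.comp g)).ker
  have hX : ∀ x, x ∈ X ↔ p • x = s (m (g x)) := fun x => by
    simp [X, AddMonoidHom.mem_ker, sub_eq_zero]
  let gX : X →+ T := g.comp X.subtype
  have hgX : Function.Surjective gX := fun t => by
    obtain ⟨b, hb, hpb⟩ := hlift t
    exact ⟨⟨b, (hX b).2 (by rw [hpb, hb]; rfl)⟩, hb⟩
  let sX : (nsmulAddMonoidHom (α := T) p).range →+ X :=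
    s.codRestrict X fun c => (hX _).2 (by rw [hs, hm, map_nsmul])
  have hsX : ∀ c, gX (sX c) = c := hs
  have hpX : ∀ x : X, p • x = sX (m (gX x)) := fun x => Subtype.ext ((hX x).1 x.2)
  obtain ⟨r, hr⟩ := AddMonoidHom.exists_retraction_of_injective (p := p)
    (K := gX.ker) (Q := X ⧸ sX.range)
    (fun x => Subtype.ext (by
      have hx : gX x = 0 := x.2
      simp [hpX, hx]))
    (fun q => by
      induction q using QuotientAddGroup.induction_on with
      | H x =>
        rw [← QuotientAddGroup.mk_nsmul, QuotientAddGroup.eq_zero_iff, hpX]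
        exact ⟨_, rfl⟩)
    ((QuotientAddGroup.mk' sX.range).comp gX.ker.subtype)
    ((injective_iff_map_eq_zero _).2 fun x hx => by
      obtain ⟨c, hc⟩ := (QuotientAddGroup.eq_zero_iff (x : X)).1 hx
      have hx0 : gX x = 0 := x.2
      have hc0 : c = 0 := Subtype.ext (by rw [← hsX, hc, hx0]; rfl)
      exact Subtype.ext (by rw [← hc, hc0, map_zero]; rfl))
  obtain ⟨s', hs'⟩ := gX.exists_section_of_retraction hgX
    (gX.ker.subtype.comp (r.comp (QuotientAddGroup.mk' sX.range)))
    (fun x => (r _).2) (fun x hx => congrArg Subtype.val (hr ⟨x, hx⟩))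
  exact ⟨X.subtype.comp s', hs'⟩

/-- A pure extension of a group of exponent `p ^ n` splits. -/
theorem AddMonoidHom.exists_section_of_pure {p : ℕ} [Fact p.Prime] (n : ℕ) {B T : Type*}
    [AddCommGroup B] [AddCommGroup T] (g : B →+ T) (hT : ∀ t : T, p ^ n • t = 0)
    (hg : ∀ (k : ℕ) (t : T), p ^ k • t = 0 → ∃ b : B, g b = t ∧ p ^ k • b = 0) :
    ∃ s : T →+ B, ∀ t, g (s t) = t := by
  induction n generalizing B T with
  | zero => exact ⟨0, fun t => by simpa using (hT t).symm⟩
  | succ n ih =>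
    let B' := (nsmulAddMonoidHom (α := B) p).range
    let T' := (nsmulAddMonoidHom (α := T) p).range
    let g' : B' →+ T' := (g.comp B'.subtype).codRestrict T' (by
      rintro ⟨_, b, rfl⟩
      exact ⟨g b, by simp⟩)
    obtain ⟨s, hs⟩ := ih g'
      (by
        rintro ⟨_, t, rfl⟩
        exact Subtype.ext (by simpa [pow_succ, mul_smul] using hT t))
      (by
        rintro k ⟨_, t, rfl⟩ ht
        have ht' : p ^ (k + 1) • t = 0 := by
          simpa [pow_succ, mul_smul] using congrArg Subtype.val ht
        obtain ⟨b, rfl, hb⟩ := hg (k + 1) t ht'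
        exact ⟨⟨p • b, b, rfl⟩, Subtype.ext (by simp [g']),
          Subtype.ext (by simpa [pow_succ, mul_smul] using hb)⟩)
    have hs' : ∀ c, g (s c) = c := fun c => congrArg Subtype.val (hs c)
    refine g.exists_section_of_section_on_multiples (B'.subtype.comp s) hs' fun t => ?_
    obtain ⟨b, hb⟩ := (s ⟨p • t, t, rfl⟩).2
    replace hb : p • b = s ⟨p • t, t, rfl⟩ := hb
    obtain ⟨d, hd, hpd⟩ := hg 1 (g b - t) (by
      rw [pow_one, smul_sub, ← map_nsmul, hb, hs', sub_self])
    refine ⟨b - d, by rw [map_sub, hd, sub_sub_cancel], ?_⟩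
    rw [pow_one] at hpd
    rw [smul_sub, hpd, sub_zero, hb]
    rfl

/-- **Main Lemma.** Let `p` be a prime, `n > 0`, and `C` an abelian group. Given, for each
`0 < k ≤ n`, an exact sequence `S_k` of `ℤ/p^k`-modules `0 → A_k → B_k → C[p^k] → 0`
(here `g k : B k →+ C` has range exactly `C[p^k]`), together with morphisms of short exact
sequences `S_k → S_{k+1}` whose right-hand vertical maps are the canonical inclusions
`C[p^k] ↪ C[p^{k+1}]`, the exact sequence `S_n` splits: the surjection `B_n → C[p^n]`
admits a group-homomorphism section. -/
theorem main_lemma_splitting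
    (p : ℕ) (hp : p.Prime) (n : ℕ) (hn : 0 < n)
    (C : Type*) [AddCommGroup C]
    (A B : ℕ → Type*) [∀ k, AddCommGroup (A k)] [∀ k, AddCommGroup (B k)]
    (f : ∀ k, A k →+ B k) (g : ∀ k, B k →+ C)
    -- `A_k` and `B_k` are `ℤ/p^k`-modules, i.e. killed by `p^k`
    (hA : ∀ k, 0 < k → k ≤ n → ∀ a : A k, p ^ k • a = 0)
    (hB : ∀ k, 0 < k → k ≤ n → ∀ b : B k, p ^ k • b = 0)
    -- exactness of `S_k` : `0 → A_k → B_k → C[p^k] → 0`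
    (hf : ∀ k, 0 < k → k ≤ n → Function.Injective (f k))
    (hfg : ∀ k, 0 < k → k ≤ n → ∀ b : B k, g k b = 0 ↔ ∃ a : A k, f k a = b)
    (hg : ∀ k, 0 < k → k ≤ n → ∀ c : C, (∃ b : B k, g k b = c) ↔ p ^ k • c = 0)
    -- the morphisms of short exact sequences `S_k → S_{k+1}`; the right-hand vertical
    -- map being the inclusion `C[p^k] ↪ C[p^{k+1}]` is encoded by `g (k+1) ∘ β k = g k`
    (α : ∀ k, A k →+ A (k + 1)) (β : ∀ k, B k →+ B (k + 1))
    (hcomm₁ : ∀ k, 0 < k → k < n → ∀ a : A k, f (k + 1) (α k a) = β k (f k a))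
    (hcomm₂ : ∀ k, 0 < k → k < n → ∀ b : B k, g (k + 1) (β k b) = g k b) :
    ∃ s : torsionSubgroup (p ^ n) C →+ B n, ∀ t, g n (s t) = (t : C) := by
  have : Fact p.Prime := ⟨hp⟩
  let gT : B n →+ torsionSubgroup (p ^ n) C :=
    (g n).codRestrict _ fun b => (hg n hn le_rfl _).1 ⟨b, rfl⟩
  have push : ∀ k, 0 < k → ∀ m, k ≤ m → m ≤ n → ∀ b : B k,
      ∃ b' : B m, g m b' = g k b ∧ p ^ k • b' = 0 := by
    intro k hk m hkm
    induction m, hkm using Nat.le_induction with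
    | base => exact fun hkn b => ⟨b, rfl, hB k hk hkn b⟩
    | succ m hkm ih =>
      intro hmn b
      obtain ⟨b', hb', hpb'⟩ := ih (by omega) b
      exact ⟨β m b', by rw [hcomm₂ m (by omega) (by omega), hb'],
        by rw [← map_nsmul, hpb', map_zero]⟩
  obtain ⟨s, hs⟩ := gT.exists_section_of_pure (p := p) n (fun t => Subtype.ext t.2)
    fun k t ht => by
      have htC : p ^ k • (t : C) = 0 := congrArg Subtype.val ht
      rcases Nat.eq_zero_or_pos k with rfl | hk
      · exact ⟨0, by simpa using ht.symm, smul_zero _⟩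
      rcases le_total k n with hkn | hnk
      · obtain ⟨b, hb⟩ := (hg k hk hkn t).2 htC
        obtain ⟨b', hb', hpb'⟩ := push k hk n hkn le_rfl b
        exact ⟨b', Subtype.ext (hb'.trans hb), hpb'⟩
      · obtain ⟨b, hb⟩ := (hg n hn le_rfl t).2 t.2
        refine ⟨b, Subtype.ext hb, ?_⟩
        rw [← Nat.sub_add_cancel hnk, pow_add, mul_smul, hB n hn le_rfl, smul_zero]
  exact ⟨s, fun t => congrArg Subtype.val (hs t)⟩
end

section
/- Let p be a prime number, n > 0 an integer, and C an abelian group. Assume that for each 0 < k ≤ n there is an exact sequence S_k of ℤ/p^k-modules 0 → A_k → B_k →^{g_k} C[p^k] → 0, together with, for each 0 < k < n, a morphism of short exact sequences from S_k to S_{k+1} in which the right-hand vertical map is the canonical inclusion C[p^k] ↪ C[p^{k+1}]. Then the exact sequence S_n is pure exact: for every t ∈ C[p^n] there exists y ∈ B_n with g_n(y) = t and y of the same order as t. -/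
/-- Let `p` be a prime, `n > 0`, and `C` an abelian group. Given, for each `0 < k ≤ n`,
an exact sequence `S_k` of `ℤ/p^k`-modules `0 → A_k → B_k →g_k→ C[p^k] → 0`
(here `g k : B k →+ C` has range exactly `C[p^k]`), together with morphisms of short exact
sequences `S_k → S_{k+1}` whose right-hand vertical maps are the canonical inclusions
`C[p^k] ↪ C[p^{k+1}]`, the exact sequence `S_n` is *pure exact*: every `t ∈ C[p^n]` has a
preimage `y` under `g_n` of the same order as `t`. -/
theorem main_lemma_pure_exact
    (p : ℕ) (hp : p.Prime) (n : ℕ) (hn : 0 < n)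
    (C : Type*) [AddCommGroup C]
    (A B : ℕ → Type*) [∀ k, AddCommGroup (A k)] [∀ k, AddCommGroup (B k)]
    (f : ∀ k, A k →+ B k) (g : ∀ k, B k →+ C)
    -- `A_k` and `B_k` are `ℤ/p^k`-modules, i.e. killed by `p^k`
    (hA : ∀ k, 0 < k → k ≤ n → ∀ a : A k, p ^ k • a = 0)
    (hB : ∀ k, 0 < k → k ≤ n → ∀ b : B k, p ^ k • b = 0)
    -- exactness of `S_k` : `0 → A_k → B_k → C[p^k] → 0`
    (hf : ∀ k, 0 < k → k ≤ n → Function.Injective (f k))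
    (hfg : ∀ k, 0 < k → k ≤ n → ∀ b : B k, g k b = 0 ↔ ∃ a : A k, f k a = b)
    (hg : ∀ k, 0 < k → k ≤ n → ∀ c : C, (∃ b : B k, g k b = c) ↔ p ^ k • c = 0)
    -- the morphisms of short exact sequences `S_k → S_{k+1}`; the right-hand vertical
    -- map being the inclusion `C[p^k] ↪ C[p^{k+1}]` is encoded by `g (k+1) ∘ β k = g k`
    (α : ∀ k, A k →+ A (k + 1)) (β : ∀ k, B k →+ B (k + 1))
    (hcomm₁ : ∀ k, 0 < k → k < n → ∀ a : A k, f (k + 1) (α k a) = β k (f k a))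
    (hcomm₂ : ∀ k, 0 < k → k < n → ∀ b : B k, g (k + 1) (β k b) = g k b) :
    ∀ t : C, p ^ n • t = 0 →
      ∃ y : B n, g n y = t ∧ addOrderOf y = addOrderOf t := by
  intro t ht
  obtain ⟨j, hjn, hj⟩ := (Nat.dvd_prime_pow hp).1 (addOrderOf_dvd_of_nsmul_eq_zero ht)
  obtain rfl | hj0 := Nat.eq_zero_or_pos j
  · have ht0 : t = 0 := by simpa using hj
    exact ⟨0, by simp [ht0]⟩
  have htj : p ^ j • t = 0 := hj ▸ addOrderOf_nsmul_eq_zero t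
  have lift_to : ∀ m, j ≤ m → m ≤ n → ∃ y : B m, g m y = t ∧ p ^ j • y = 0 := by
    intro m hjm
    induction m, hjm using Nat.le_induction with
    | base =>
      intro _
      obtain ⟨y, hy⟩ := (hg j hj0 hjn t).2 htj
      exact ⟨y, hy, hB j hj0 hjn y⟩
    | succ m hjm ih =>
      intro hmn
      obtain ⟨y, hy, hyj⟩ := ih (by omega)
      exact ⟨β m y, by rw [hcomm₂ m (by omega) hmn, hy], by rw [← map_nsmul, hyj, map_zero]⟩
  obtain ⟨y, hy, hyj⟩ := lift_to n hjn le_rfl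
  refine ⟨y, hy, Nat.dvd_antisymm ?_ ?_⟩
  · exact hj ▸ addOrderOf_dvd_of_nsmul_eq_zero hyj
  · exact hy ▸ addOrderOf_map_dvd (g n) y
end

section
/- Let 0 → A → B →^{g} C → 0 be a pure exact sequence of abelian groups. If C is a direct sum of cyclic groups, then the sequence splits: g admits a group-homomorphism section. -/
open DirectSum

/-- A homomorphism out of a cyclic group lifts along `g` as soon as every element of the target
of `g` has a preimage whose order is the same. -/
theorem exists_lift_of_isAddCyclic {B C Z : Type*} [AddCommGroup B] [AddCommGroup C]
    [AddCommGroup Z] [IsAddCyclic Z] (g : B →+ C)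
    (hpure : ∀ c : C, ∃ b : B, g b = c ∧ addOrderOf b = addOrderOf c) (φ : Z →+ C) :
    ∃ s : Z →+ B, g.comp s = φ := by
  obtain ⟨z, hz⟩ := IsAddCyclic.exists_generator (α := Z)
  obtain ⟨b, hb, hord⟩ := hpure (φ z)
  have hdvd : addOrderOf b ∣ addOrderOf z := hord ▸ addOrderOf_map_dvd φ z
  refine ⟨addMonoidHomOfForallMemZMultiples hz hdvd, ?_⟩
  ext x
  obtain ⟨n, rfl⟩ := AddSubgroup.mem_zmultiples_iff.mp (hz x)
  simp [addMonoidHomOfForallMemZMultiples_apply_gen, hb]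

/-- If `0 → A → B →g→ C → 0` is a pure exact sequence of abelian groups and `C` is a
direct sum of cyclic groups, then the sequence splits: `g` admits a group-homomorphism
section. -/
theorem pure_exact_splits_of_directSum_of_cyclic
    (A B C : Type*) [AddCommGroup A] [AddCommGroup B] [AddCommGroup C]
    (f : A →+ B) (g : B →+ C)
    -- `0 → A → B → C → 0` is a short exact sequence
    (hf : Function.Injective f)
    (hfg : ∀ b : B, g b = 0 ↔ ∃ a : A, f a = b)
    (hg : Function.Surjective g)
    -- purity: every `c` has a preimage of the same order
    (hpure : ∀ c : C, ∃ b : B, g b = c ∧ addOrderOf b = addOrderOf c)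
    -- `C` is a direct sum of cyclic groups
    (ι : Type*) (D : ι → Type*) [∀ i, AddCommGroup (D i)] [∀ i, IsAddCyclic (D i)]
    (hC : Nonempty (C ≃+ ⨁ i, D i)) :
    ∃ s : C →+ B, ∀ c : C, g (s c) = c := by
  classical
  obtain ⟨e⟩ := hC
  choose s hs using fun i ↦ exists_lift_of_isAddCyclic g hpure
    (e.symm.toAddMonoidHom.comp (DirectSum.of D i))
  have hsection : g.comp (DirectSum.toAddMonoid s) = e.symm.toAddMonoidHom := by
    refine DirectSum.addHom_ext fun i y ↦ ?_
    simpa using DFunLike.congr_fun (hs i) y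
  refine ⟨(DirectSum.toAddMonoid s).comp e.toAddMonoidHom, fun c ↦ ?_⟩
  simpa using DFunLike.congr_fun hsection (e c)
end

section
/- Let p be a prime number, n > 0 an integer, and A an abelian group. Assume that for each 0 < k ≤ n there is an exact sequence S_k of ℤ/p^k-modules 0 → A/p^k → B_k → C_k → 0, together with, for each 0 < k < n, a morphism of short exact sequences from S_{k+1} to S_k (maps A/p^{k+1} → A/p^k, B_{k+1} → B_k, C_{k+1} → C_k forming commutative squares) in which the left-hand vertical map is the canonical surjection A/p^{k+1} ↠ A/p^k. Then the exact sequence S_n splits. -/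
/-- The subgroup `m·A` of an abelian group `A`. -/
def multiplesSubgroup (m : ℕ) (A : Type*) [AddCommGroup A] : AddSubgroup A where
  carrier := Set.range (fun a : A => m • a)
  zero_mem' := ⟨0, smul_zero m⟩
  add_mem' := by
    rintro _ _ ⟨a, rfl⟩ ⟨b, rfl⟩
    exact ⟨a + b, smul_add m a b⟩
  neg_mem' := by
    rintro _ ⟨a, rfl⟩
    exact ⟨-a, smul_neg m a⟩

/-- The quotient `A/m := A/mA` of an abelian group `A`. -/
abbrev ModM (m : ℕ) (A : Type*) [AddCommGroup A] := A ⧸ multiplesSubgroup m A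

/-- The canonical surjection `A/p^{k+1} ↠ A/p^k`, induced by the identity of `A`. -/
def canonicalSurjection (p k : ℕ) (A : Type*) [AddCommGroup A] :
    ModM (p ^ (k + 1)) A →+ ModM (p ^ k) A :=
  QuotientAddGroup.map _ _ (AddMonoidHom.id A) (by
    rintro _ ⟨a, rfl⟩
    refine ⟨p • a, ?_⟩
    show p ^ k • p • a = AddMonoidHom.id A (p ^ (k + 1) • a)
    rw [AddMonoidHom.id_apply, ← mul_smul, ← pow_succ])

/-- An integer is either divisible by `p ^ t`, or is `p ^ s` times an integer coprime to `p`
for some `s < t`. -/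
theorem Int.pow_dvd_or_eq_pow_mul_isCoprime {p : ℕ} (hp : p.Prime) (t : ℕ) (j : ℤ) :
    (p : ℤ) ^ t ∣ j ∨ ∃ s < t, ∃ u : ℤ, j = (p : ℤ) ^ s * u ∧ IsCoprime u (p : ℤ) := by
  have hp' : Prime (p : ℤ) := Nat.prime_iff_prime_int.mp hp
  by_cases hj : j = 0
  · exact Or.inl (hj ▸ dvd_zero _)
  obtain ⟨s, u, hu, rfl⟩ :=
    WfDvdMonoid.max_power_factor hj hp'.irreducible
  by_cases hst : s < t
  · exact Or.inr ⟨s, hst, u, rfl, ((Prime.coprime_iff_not_dvd hp').mpr hu).symm⟩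
  · exact Or.inl ((pow_dvd_pow _ (not_lt.mp hst)).mul_right _)

namespace AddSubgroup

variable {B : Type*} [AddCommGroup B]

/-- The image of `H` in `B ⧸ K` is `p`-pure, and `H ⊓ K ≤ p ^ k • H` for all `k`. -/
def IsPPureModulo (p : ℕ) (H K : AddSubgroup B) : Prop :=
  ∀ k : ℕ, ∀ h ∈ H, ∀ x ∈ K, ∀ b : B, h = x + p ^ k • b → ∃ h' ∈ H, h = p ^ k • h'

theorem exists_le_maximal_isPPureModulo (p : ℕ) (H K : AddSubgroup B)
    (hK : IsPPureModulo p H K) : ∃ M, K ≤ M ∧ Maximal (IsPPureModulo p H) M := by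
  refine zorn_le_nonempty₀ {K | IsPPureModulo p H K} (fun c hc hchain L hL => ?_) K hK
  refine ⟨sSup c, fun k h hh x hx => ?_, fun M hM => le_sSup hM⟩
  obtain ⟨M, hM, hxM⟩ := (mem_sSup_of_directedOn ⟨L, hL⟩ hchain.directedOn).mp hx
  exact hc hM k h hh x hxM

/-- If `B` is not exhausted by `H ⊔ K`, then `K` can be enlarged by a lift of an element of maximal
order in `B ⧸ (H ⊔ K)`, preserving purity of `H`. -/
theorem IsPPureModulo.exists_notMem_sup_zmultiples {p : ℕ} (hp : p.Prime) {n : ℕ}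
    (hB : ∀ b : B, p ^ n • b = 0) {H K : AddSubgroup B} (hK : IsPPureModulo p H K)
    (hne : H ⊔ K ≠ ⊤) : ∃ y ∉ K, IsPPureModulo p H (K ⊔ zmultiples y) := by
  classical
  have hex : ∃ m, ∀ b : B, p ^ m • b ∈ H ⊔ K := ⟨n, fun b => hB b ▸ zero_mem _⟩
  obtain ⟨m, hm, hmin⟩ : ∃ m, (∀ b : B, p ^ m • b ∈ H ⊔ K) ∧
      ∀ l < m, ¬ ∀ b : B, p ^ l • b ∈ H ⊔ K :=
    ⟨Nat.find hex, Nat.find_spec hex, fun l hl => Nat.find_min hex hl⟩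
  obtain _ | m := m
  · exact absurd (eq_top_iff.mpr fun b _ => by simpa using hm b) hne
  obtain ⟨x, hx⟩ := not_forall.mp (hmin m m.lt_succ_self)
  obtain ⟨a, ha, z, hz, haz⟩ := mem_sup.mp (hm x)
  obtain ⟨h', hh', rfl⟩ := hK (m + 1) a ha (-z) (neg_mem hz) x (by rw [← haz]; abel)
  have hy : p ^ m • (x - h') ∉ H ⊔ K := fun hmem => hx <| by
    have := add_mem hmem (nsmul_mem (le_sup_left (b := K) hh') (p ^ m))
    rwa [← smul_add, sub_add_cancel] at this
  have hyK : p ^ (m + 1) • (x - h') ∈ K := by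
    rwa [smul_sub, ← haz, add_sub_cancel_left]
  generalize x - h' = y at hy hyK
  clear ha hz haz
  refine ⟨y, fun hmem => hy (le_sup_right (a := H) (nsmul_mem hmem _)), ?_⟩
  intro k h hh w hw b hb
  obtain ⟨z, hz, v, hv, rfl⟩ := mem_sup.mp hw
  obtain ⟨j, rfl⟩ := mem_zmultiples_iff.mp hv
  obtain ⟨i, rfl⟩ | ⟨s, hs, u, rfl, hu⟩ :=
    Int.pow_dvd_or_eq_pow_mul_isCoprime hp (min k (m + 1)) j
  · rcases le_total k (m + 1) with hkm | hkm
    · refine hK k h hh z hz (i • y + b) ?_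
      rw [hb, min_eq_left hkm, mul_smul, smul_add, add_assoc, ← natCast_zsmul, ← natCast_zsmul]
      push_cast
      rfl
    · refine hK k h hh _ (add_mem hz ?_) b hb
      rw [min_eq_right hkm, mul_comm, mul_smul]
      refine zsmul_mem ?_ i
      rw [← natCast_zsmul] at hyK
      exact_mod_cast hyK
  · exfalso
    obtain ⟨hsk, hsm⟩ := lt_min_iff.mp hs
    obtain ⟨r, rfl⟩ := Nat.exists_eq_add_of_le (Nat.lt_succ_iff.mp hsm)
    obtain ⟨q, rfl⟩ := Nat.exists_eq_add_of_lt hsk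
    have hmem : u • p ^ (s + r) • y ∈ H ⊔ K := by
      have h₁ : p ^ r • (h - z) - p ^ (s + r + 1) • p ^ q • b ∈ H ⊔ K :=
        sub_mem (nsmul_mem (sub_mem (le_sup_left (b := K) hh) (le_sup_right (a := H) hz)) _) (hm _)
      convert h₁ using 1
      rw [hb]
      simp only [← natCast_zsmul]
      push_cast
      module
    have hmem' : (p : ℤ) • p ^ (s + r) • y ∈ H ⊔ K := by
      rw [natCast_zsmul, ← mul_smul, ← pow_succ']
      exact hm y
    obtain ⟨c, d, hcd⟩ := hu
    apply hy
    rw [← one_zsmul (p ^ (s + r) • y), ← hcd, add_smul, mul_smul, mul_smul]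
    exact add_mem (zsmul_mem hmem _) (zsmul_mem hmem' _)

/-- A `p`-pure subgroup of an abelian group killed by `p ^ n` is a direct summand. -/
theorem exists_isCompl_of_isPPureModulo_bot {p : ℕ} (hp : p.Prime) {n : ℕ}
    (hB : ∀ b : B, p ^ n • b = 0) {H : AddSubgroup B} (hH : IsPPureModulo p H ⊥) :
    ∃ K, IsCompl H K := by
  obtain ⟨K, -, hK⟩ := exists_le_maximal_isPPureModulo p H ⊥ hH
  refine ⟨K, disjoint_def.mpr fun {x} hxH hxK => ?_, codisjoint_iff.mpr ?_⟩
  · obtain ⟨h', -, rfl⟩ := hK.prop n x hxH x hxK 0 (by simp)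
    exact hB h'
  · by_contra hne
    obtain ⟨y, hy, hyK⟩ := hK.prop.exists_notMem_sup_zmultiples hp hB hne
    exact hy (hK.le_of_ge hyK le_sup_left (le_sup_right (a := K) (mem_zmultiples y)))

end AddSubgroup

theorem AddMonoidHom.exists_section_of_isCompl_ker {B C : Type*} [AddCommGroup B] [AddCommGroup C]
    {g : B →+ C} (hg : Function.Surjective g) {K : AddSubgroup B} (hK : IsCompl g.ker K) :
    ∃ s : C →+ B, ∀ c, g (s c) = c := by
  have hbij : Function.Bijective (g.comp K.subtype) := by
    refine ⟨(injective_iff_map_eq_zero _).mpr fun x hx => ?_, fun c => ?_⟩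
    · exact Subtype.ext (AddSubgroup.disjoint_def.mp hK.disjoint hx x.2)
    · obtain ⟨b, rfl⟩ := hg c
      have hb : b ∈ g.ker ⊔ K := hK.sup_eq_top ▸ AddSubgroup.mem_top b
      obtain ⟨h, hh, z, hz, rfl⟩ := AddSubgroup.mem_sup.mp hb
      exact ⟨⟨z, hz⟩, by simp [AddMonoidHom.mem_ker.mp hh]⟩
  let e := AddEquiv.ofBijective _ hbij
  exact ⟨K.subtype.comp e.symm.toAddMonoidHom, fun c => e.apply_symm_apply c⟩

/-- **Dual of the Main Lemma.** Let `p` be a prime, `n > 0`, and `A` an abelian group.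
Given, for each `0 < k ≤ n`, an exact sequence `S_k` of `ℤ/p^k`-modules
`0 → A/p^k → B_k → C_k → 0`, together with morphisms of short exact sequences
`S_{k+1} → S_k` whose left-hand vertical maps are the canonical surjections
`A/p^{k+1} ↠ A/p^k`, the exact sequence `S_n` splits. -/
theorem dual_main_lemma_splitting
    (p : ℕ) (hp : p.Prime) (n : ℕ) (hn : 0 < n)
    (A : Type*) [AddCommGroup A]
    (B C : ℕ → Type*) [∀ k, AddCommGroup (B k)] [∀ k, AddCommGroup (C k)]
    (f : ∀ k, ModM (p ^ k) A →+ B k) (g : ∀ k, B k →+ C k)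
    -- `B_k` and `C_k` are `ℤ/p^k`-modules, i.e. killed by `p^k`
    (hB : ∀ k, 0 < k → k ≤ n → ∀ b : B k, p ^ k • b = 0)
    (hC : ∀ k, 0 < k → k ≤ n → ∀ c : C k, p ^ k • c = 0)
    -- exactness of `S_k` : `0 → A/p^k → B_k → C_k → 0`
    (hf : ∀ k, 0 < k → k ≤ n → Function.Injective (f k))
    (hfg : ∀ k, 0 < k → k ≤ n → ∀ b : B k, g k b = 0 ↔ ∃ a, f k a = b)
    (hg : ∀ k, 0 < k → k ≤ n → Function.Surjective (g k))
    -- the morphisms of short exact sequences `S_{k+1} → S_k`, whose left-hand vertical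
    -- map is the canonical surjection `A/p^{k+1} ↠ A/p^k`
    (β : ∀ k, B (k + 1) →+ B k) (γ : ∀ k, C (k + 1) →+ C k)
    (hcomm₁ : ∀ k, 0 < k → k < n → ∀ a : ModM (p ^ (k + 1)) A,
      f k (canonicalSurjection p k A a) = β k (f (k + 1) a))
    (hcomm₂ : ∀ k, 0 < k → k < n → ∀ b : B (k + 1), γ k (g (k + 1) b) = g k (β k b)) :
    ∃ s : C n →+ B n, ∀ c : C n, g n (s c) = c := by
  have key : ∀ k, 0 < k → ∀ j, k ≤ j → j ≤ n → ∀ (a : A) (b : B j),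
      f j (QuotientAddGroup.mk a) = p ^ k • b → a ∈ multiplesSubgroup (p ^ k) A := by
    intro k hk j hkj
    induction j, hkj using Nat.le_induction with
    | base =>
      intro hkn a b hab
      rw [hB k hk hkn] at hab
      exact (QuotientAddGroup.eq_zero_iff a).mp
        ((injective_iff_map_eq_zero (f k)).mp (hf k hk hkn) _ hab)
    | succ j hkj ih =>
      intro hjn a b hab
      refine ih (by omega) a (β j b) ?_
      rw [← map_nsmul, ← hab, ← hcomm₁ j (by omega) (by omega)]
      rfl
  have hpure : AddSubgroup.IsPPureModulo p (g n).ker ⊥ := by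
    rintro k h hh x hx b rfl
    obtain rfl := AddSubgroup.mem_bot.mp hx
    rw [zero_add] at hh ⊢
    rcases le_total n k with hnk | hkn
    · refine ⟨0, zero_mem _, ?_⟩
      obtain ⟨i, rfl⟩ := Nat.exists_eq_add_of_le hnk
      rw [pow_add, mul_smul, hB n hn le_rfl, smul_zero]
    rcases k.eq_zero_or_pos with rfl | hk
    · exact ⟨b, by simpa using hh, rfl⟩
    obtain ⟨a, ha⟩ := (hfg n hn le_rfl _).mp hh
    obtain ⟨a, rfl⟩ := QuotientAddGroup.mk_surjective a
    obtain ⟨a', rfl⟩ := key k hk n hkn le_rfl a b ha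
    refine ⟨f n (QuotientAddGroup.mk a'), (hfg n hn le_rfl _).mpr ⟨_, rfl⟩, ?_⟩
    rw [← ha, ← map_nsmul]
    rfl
  obtain ⟨K, hK⟩ := AddSubgroup.exists_isCompl_of_isPPureModulo_bot hp (hB n hn le_rfl) hpure
  exact AddMonoidHom.exists_section_of_isCompl_ker (hg n hn le_rfl) hK
end

section
/- Let p be a prime and C an abelian group. Suppose given, for every integer k > 0, an exact sequence S_k of ℤ/p^k-modules 0 → A_k → B_k → C[p^k] → 0 and, for every k > 0, a morphism of short exact sequences S_k → S_{k+1} whose right-hand map is the canonical inclusion C[p^k] ↪ C[p^{k+1}]. Assume moreover that the direct limit of the A_k admits a decomposition colim A_k ≅ D ⊕ M where D is a divisible abelian group and M is a torsion abelian group of bounded exponent. Then the direct limit exact sequence 0 → colim A_k → colim B_k → C[p^∞] → 0 splits. -/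
/-- The `p`-primary torsion subgroup `C[p^∞] = ∪ₖ C[p^k]` of an abelian group `C`. -/
def pPrimarySubgroup (p : ℕ) (C : Type*) [AddCommGroup C] : AddSubgroup C where
  carrier := {c | ∃ k : ℕ, p ^ k • c = 0}
  zero_mem' := ⟨0, smul_zero _⟩
  add_mem' := by
    rintro a b ⟨k, hk⟩ ⟨l, hl⟩
    refine ⟨k + l, ?_⟩
    have h1 : p ^ (k + l) • a = 0 := by rw [add_comm, pow_add, mul_smul, hk, smul_zero]
    have h2 : p ^ (k + l) • b = 0 := by rw [pow_add, mul_smul, hl, smul_zero]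
    rw [smul_add, h1, h2, add_zero]
  neg_mem' := by
    rintro a ⟨k, hk⟩
    exact ⟨k, by rw [smul_neg, hk, neg_zero]⟩

/-- The composite transition map `X_k →+ X_{k+l}` of a direct system given by the
consecutive maps `e k : X k →+ X (k+1)`. -/
def chainMap {X : ℕ → Type*} [∀ k, AddCommGroup (X k)] (e : ∀ k, X k →+ X (k + 1)) :
    ∀ (k l : ℕ), X k →+ X (k + l)
  | _, 0 => AddMonoidHom.id _
  | k, l + 1 => (e (k + l)).comp (chainMap e k l)

/-- An additive subgroup of `B × E` which is the graph of a partial homomorphism `B → E`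
that does not decrease `p`-heights. -/
structure IsHeightGraph {B E : Type*} [AddCommGroup B] [AddCommGroup E] (p : ℕ)
    (G : AddSubgroup (B × E)) : Prop where
  eq_zero : ∀ z ∈ G, z.1 = 0 → z.2 = 0
  height_le : ∀ z ∈ G, ∀ j : ℕ, (∃ b : B, p ^ j • b = z.1) → ∃ e : E, p ^ j • e = z.2

theorem exists_pow_smul_of_stable {E : Type*} [AddCommGroup E] {p n : ℕ}
    (hE : ∀ e : E, ∃ e' : E, p ^ (n + 1) • e' = p ^ n • e) (e : E) (i : ℕ) :
    ∃ e' : E, p ^ (n + i) • e' = p ^ n • e := by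
  induction i with
  | zero => exact ⟨e, rfl⟩
  | succ i ih =>
    obtain ⟨e₁, h₁⟩ := ih
    obtain ⟨e₂, h₂⟩ := hE e₁
    refine ⟨e₂, ?_⟩
    rw [← h₁, show n + (i + 1) = i + (n + 1) by ring, pow_add, mul_smul, h₂, ← mul_smul,
      ← pow_add, add_comm]

/-- A maximal height-nondecreasing partial homomorphism into a group whose chain of subgroups
`p ^ j • E` is stationary has a `p`-saturated domain. -/
theorem IsHeightGraph.exists_mem_of_smul_mem {B E : Type*} [AddCommGroup B] [AddCommGroup E]
    {p n : ℕ} (hp : p.Prime) (hE : ∀ e : E, ∃ e' : E, p ^ (n + 1) • e' = p ^ n • e)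
    {G : AddSubgroup (B × E)} (hG : IsHeightGraph p G)
    (hmax : ∀ G' : AddSubgroup (B × E), IsHeightGraph p G' → G ≤ G' → G' ≤ G)
    {b : B} (hb : ∃ e, (p • b, e) ∈ G) : ∃ e, (b, e) ∈ G := by
  classical
  by_contra hbG
  -- choose a representative of the coset of `b` of largest height, capped at `n`
  let P : ℕ → Prop := fun j => ∃ z ∈ G, ∃ c : B, p ^ j • c = b + z.1
  obtain ⟨j, -, ⟨z, hz, c, hc⟩, hjmax⟩ : ∃ j ≤ n, P j ∧ ∀ l ≤ n, P l → l ≤ j :=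
    ⟨Nat.findGreatest P n, Nat.findGreatest_le n,
      Nat.findGreatest_spec (m := 0) (Nat.zero_le n) ⟨0, G.zero_mem, b, by simp⟩,
      fun l hl hPl => Nat.le_findGreatest hl hPl⟩
  obtain ⟨e, he⟩ := hb
  set b' := b + z.1 with hb'
  have hpb' : (p • b', e + p • z.2) ∈ G := by
    have := G.add_mem he (G.nsmul_mem hz p)
    rwa [show (p • b, e) + p • z = (p • b', e + p • z.2) by
      ext <;> simp [hb', smul_add]] at this
  obtain ⟨e₀, he₀⟩ := hG.height_le _ hpb' (j + 1) ⟨c, by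
    rw [pow_succ', mul_smul, hc]⟩
  set m := p ^ j • e₀ with hm
  have hpm : (p • b', p • m) ∈ G := by
    rwa [hm, ← mul_smul, ← pow_succ', he₀]
  have hb'G : ∀ y ∈ G, y.1 ≠ b' := by
    intro y hy hyb
    refine hbG ⟨y.2 - z.2, ?_⟩
    have := G.sub_mem hy hz
    rwa [show y - z = (b, y.2 - z.2) by ext <;> simp [hyb, hb']] at this
  have hdvd : ∀ g ∈ G, ∀ i : ℤ, (p : ℤ) ∣ i → g + i • (b', m) ∈ G := by
    rintro g hg _ ⟨t, rfl⟩
    refine G.add_mem hg ?_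
    have := G.zsmul_mem hpm t
    rwa [show t • (p • b', p • m) = ((p : ℤ) * t) • (b', m) by
      ext <;> simp only [Prod.smul_mk] <;> module] at this
  have hndvd : ∀ g ∈ G, ∀ i : ℤ, ¬ (p : ℤ) ∣ i →
      ∃ u : ℤ, ∃ y ∈ G, u • (g.1 + i • b') = y.1 + b' := by
    intro g hg i hi
    obtain ⟨v, u, huv⟩ := ((Nat.prime_iff_prime_int.mp hp).coprime_iff_not_dvd).mpr hi
    refine ⟨u, u • g - v • (p • b', p • m), G.sub_mem (G.zsmul_mem hg u)
      (G.zsmul_mem hpm v), ?_⟩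
    have hu : (u * i) • b' = b' - (v * p) • b' := by
      rw [show u * i = 1 - v * p by linarith, sub_smul, one_smul]
    simp only [Prod.fst_sub, Prod.smul_fst]
    rw [smul_add, ← mul_smul, hu, mul_smul, natCast_zsmul]
    abel
  have hG' : IsHeightGraph p (G ⊔ AddSubgroup.zmultiples (b', m)) := by
    constructor
    · intro w hw hw0
      obtain ⟨g, hg, _, ⟨i, rfl⟩, rfl⟩ := AddSubgroup.mem_sup.mp hw
      by_cases hi : (p : ℤ) ∣ i
      · exact hG.eq_zero _ (hdvd g hg i hi) hw0
      · obtain ⟨u, y, hy, h⟩ := hndvd g hg i hi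
        have h0 : g.1 + i • b' = 0 := hw0
        rw [h0, smul_zero] at h
        exact absurd (eq_neg_of_add_eq_zero_right h.symm).symm
          (by simpa using hb'G _ (G.neg_mem hy))
    · intro w hw l hl
      obtain ⟨g, hg, _, ⟨i, rfl⟩, rfl⟩ := AddSubgroup.mem_sup.mp hw
      by_cases hi : (p : ℤ) ∣ i
      · exact hG.height_le _ (hdvd g hg i hi) l hl
      obtain ⟨u, y, hy, h⟩ := hndvd g hg i hi
      have key : ∀ l ≤ n, (∃ d : B, p ^ l • d = g.1 + i • b') →
          ∃ e : E, p ^ l • e = g.2 + i • m := by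
        rintro l hln ⟨d, hd⟩
        have hlj : l ≤ j := hjmax l hln ⟨z + y, G.add_mem hz hy, u • d, by
          rw [smul_comm, hd, h, hb', Prod.fst_add]; abel⟩
        obtain ⟨q, rfl⟩ := Nat.exists_eq_add_of_le hlj
        obtain ⟨e₁, he₁⟩ := hG.height_le g hg l ⟨d - i • p ^ q • c, by
          rw [smul_sub, hd, smul_comm _ i, ← mul_smul (p ^ l), ← pow_add, hc]; abel⟩
        refine ⟨e₁ + i • p ^ q • e₀, ?_⟩
        rw [smul_add, he₁, smul_comm _ i, ← mul_smul (p ^ l), ← pow_add]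
      rcases le_total l n with hln | hln
      · exact key l hln hl
      · obtain ⟨q, rfl⟩ := Nat.exists_eq_add_of_le hln
        obtain ⟨d, hd⟩ := hl
        obtain ⟨e₁, he₁⟩ := key n le_rfl ⟨p ^ q • d, by rw [← mul_smul, ← pow_add]; exact hd⟩
        obtain ⟨e₂, he₂⟩ := exists_pow_smul_of_stable hE e₁ q
        exact ⟨e₂, he₂.trans he₁⟩
  exact hb'G _ (hmax _ hG' le_sup_left
    (AddSubgroup.mem_sup_right (AddSubgroup.mem_zmultiples (b', m)))) rfl

/-- A pure subgroup of a `p`-primary group whose chain of subgroups `p ^ j • A` is stationary is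
a direct summand. -/
theorem exists_retraction_of_pure_of_stable {A B : Type*} [AddCommGroup A] [AddCommGroup B]
    {p n : ℕ} (hp : p.Prime) (hA : ∀ a : A, ∃ a' : A, p ^ (n + 1) • a' = p ^ n • a)
    (hB : ∀ b : B, ∃ k : ℕ, p ^ k • b = 0) (f : A →+ B) (hf : Function.Injective f)
    (hpure : ∀ (j : ℕ) (a : A), (∃ b : B, p ^ j • b = f a) → ∃ a' : A, p ^ j • a' = a) :
    ∃ r : B →+ A, ∀ a, r (f a) = a := by
  let G₀ : AddSubgroup (B × A) := (f.prod (AddMonoidHom.id A)).range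
  have hG₀ : IsHeightGraph p G₀ := by
    constructor
    · rintro _ ⟨a, rfl⟩ h
      exact (injective_iff_map_eq_zero f).mp hf a h
    · rintro _ ⟨a, rfl⟩ j h
      exact hpure j a h
  obtain ⟨G, hle, hGmax⟩ := zorn_le_nonempty₀ {G : AddSubgroup (B × A) | IsHeightGraph p G}
    (by
      intro S hS hchain G₁ hG₁
      have hmem : ∀ z, z ∈ sSup S ↔ ∃ G ∈ S, z ∈ G := fun z =>
        AddSubgroup.mem_sSup_of_directedOn ⟨G₁, hG₁⟩ hchain.directedOn
      refine ⟨sSup S, ⟨?_, ?_⟩, fun G hG => le_sSup hG⟩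
      · intro z hz
        obtain ⟨G, hG, hzG⟩ := (hmem z).mp hz
        exact (hS hG).eq_zero z hzG
      · intro z hz
        obtain ⟨G, hG, hzG⟩ := (hmem z).mp hz
        exact (hS hG).height_le z hzG) G₀ hG₀
  have hG : IsHeightGraph p G := hGmax.prop
  have hsat : ∀ (k : ℕ) (b : B), (∃ a, (p ^ k • b, a) ∈ G) → ∃ a, (b, a) ∈ G := by
    intro k
    induction k with
    | zero => intro b h; simpa using h
    | succ k ih =>
      intro b h
      refine hG.exists_mem_of_smul_mem hp hA (fun G' h' h'' => hGmax.le_of_ge h' h'')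
        (ih (p • b) ?_)
      rwa [← mul_smul, ← pow_succ]
  have htotal : ∀ b : B, ∃ a, (b, a) ∈ G := by
    intro b
    obtain ⟨k, hk⟩ := hB b
    exact hsat k b ⟨0, by rw [hk]; exact G.zero_mem⟩
  have huniq : ∀ {b : B} {a a' : A}, (b, a) ∈ G → (b, a') ∈ G → a = a' := fun h h' =>
    sub_eq_zero.mp (hG.eq_zero _ (G.sub_mem h h') (sub_self _))
  choose r hr using htotal
  exact ⟨AddMonoidHom.mk' r fun x y => huniq (hr (x + y)) (G.add_mem (hr x) (hr y)),
    fun a => huniq (hr (f a)) (hle ⟨a, rfl⟩)⟩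

/-- In a `p`-primary group `E ≅ D × M` with `D` divisible and `M` of bounded exponent, the chain
of subgroups `p ^ j • E` is stationary. -/
theorem exists_stable_of_divisible_prod_bounded {E D M : Type*} [AddCommGroup E]
    [AddCommGroup D] [AddCommGroup M] {p : ℕ} (hp : p.Prime)
    (hE : ∀ e : E, ∃ k : ℕ, p ^ k • e = 0)
    (hD : ∀ m : ℕ, 0 < m → ∀ d : D, ∃ e : D, m • e = d)
    (hM : ∃ m : ℕ, 0 < m ∧ ∀ x : M, m • x = 0) (φ : E ≃+ D × M) :
    ∃ n : ℕ, ∀ e : E, ∃ e' : E, p ^ (n + 1) • e' = p ^ n • e := by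
  obtain ⟨m, hm, hmM⟩ := hM
  obtain ⟨n, q, hq, rfl⟩ := Nat.exists_eq_pow_mul_and_not_dvd hm.ne' p hp.ne_one
  refine ⟨n, fun e => ?_⟩
  have hx : p ^ n • (φ e).2 = 0 := by
    obtain ⟨k, hk⟩ := hE e
    have h₁ : p ^ k • p ^ n • (φ e).2 = 0 := by
      rw [smul_comm, ← Prod.smul_snd, ← map_nsmul, hk, map_zero, Prod.snd_zero, smul_zero]
    have h₂ : q • p ^ n • (φ e).2 = 0 := by
      rw [← mul_smul, mul_comm, hmM]
    have hcop : Nat.Coprime (p ^ k) q := ((Nat.Prime.coprime_iff_not_dvd hp).mpr hq).pow_left k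
    have := Nat.dvd_gcd (addOrderOf_dvd_of_nsmul_eq_zero h₁) (addOrderOf_dvd_of_nsmul_eq_zero h₂)
    rw [hcop] at this
    exact AddMonoid.addOrderOf_eq_one_iff.mp (Nat.dvd_one.mp this)
  obtain ⟨d, hd⟩ := hD (p ^ (n + 1)) (pow_pos hp.pos _) (p ^ n • (φ e).1)
  refine ⟨φ.symm (d, 0), φ.injective ?_⟩
  rw [map_nsmul, map_nsmul, φ.apply_symm_apply]
  ext
  · exact hd
  · simp [hx]

theorem apply_chainMap {X : ℕ → Type*} [∀ k, AddCommGroup (X k)]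
    {e : ∀ k, X k →+ X (k + 1)} {Y : Type*} [AddCommGroup Y] {u : ∀ k, X k →+ Y}
    (hu : ∀ k, 1 ≤ k → (u (k + 1)).comp (e k) = u k) {k : ℕ} (hk : 1 ≤ k) (l : ℕ) (x : X k) :
    u (k + l) (chainMap e k l x) = u k x := by
  induction l with
  | zero => rfl
  | succ l ih => exact (DFunLike.congr_fun (hu (k + l) (by omega)) _).trans ih

theorem chainMap_comm {X Y : ℕ → Type*} [∀ k, AddCommGroup (X k)] [∀ k, AddCommGroup (Y k)]
    {α : ∀ k, X k →+ X (k + 1)} {β : ∀ k, Y k →+ Y (k + 1)} {f : ∀ k, X k →+ Y k}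
    (hf : ∀ k, 1 ≤ k → ∀ x : X k, f (k + 1) (α k x) = β k (f k x)) {k : ℕ} (hk : 1 ≤ k)
    (l : ℕ) (x : X k) : f (k + l) (chainMap α k l x) = chainMap β k l (f k x) := by
  induction l with
  | zero => rfl
  | succ l ih => exact (hf (k + l) (by omega) _).trans (congrArg (β (k + l)) ih)

/-- Let `p` be a prime and `C` an abelian group. Suppose given, for every `k ≥ 1`, an exact
sequence `S_k` of `ℤ/p^k`-modules `0 → A_k → B_k → C[p^k] → 0` and morphisms of short exact
sequences `S_k → S_{k+1}` whose right-hand maps are the canonical inclusions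
`C[p^k] ↪ C[p^{k+1}]`. If the direct limit of the `A_k` decomposes as `D ⊕ M` with `D`
divisible and `M` torsion of bounded exponent, then the direct limit exact sequence
`0 → colim A_k → colim B_k → C[p^∞] → 0` splits. -/
theorem direct_limit_splits_of_divisible_oplus_bounded
    (p : ℕ) (hp : p.Prime)
    (C : Type*) [AddCommGroup C]
    (A B : ℕ → Type*) [∀ k, AddCommGroup (A k)] [∀ k, AddCommGroup (B k)]
    (f : ∀ k, A k →+ B k) (g : ∀ k, B k →+ C)
    -- `A_k` and `B_k` are `ℤ/p^k`-modules, i.e. killed by `p^k`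
    (hA : ∀ k, 1 ≤ k → ∀ a : A k, p ^ k • a = 0)
    (hB : ∀ k, 1 ≤ k → ∀ b : B k, p ^ k • b = 0)
    -- exactness of `S_k` : `0 → A_k → B_k → C[p^k] → 0`
    (hf : ∀ k, 1 ≤ k → Function.Injective (f k))
    (hfg : ∀ k, 1 ≤ k → ∀ b : B k, g k b = 0 ↔ ∃ a : A k, f k a = b)
    (hg : ∀ k, 1 ≤ k → ∀ c : C, (∃ b : B k, g k b = c) ↔ p ^ k • c = 0)
    -- the morphisms of short exact sequences `S_k → S_{k+1}`; the right-hand vertical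
    -- map being the inclusion `C[p^k] ↪ C[p^{k+1}]` is encoded by `g (k+1) ∘ β k = g k`
    (α : ∀ k, A k →+ A (k + 1)) (β : ∀ k, B k →+ B (k + 1))
    (hcomm₁ : ∀ k, 1 ≤ k → ∀ a : A k, f (k + 1) (α k a) = β k (f k a))
    (hcomm₂ : ∀ k, 1 ≤ k → ∀ b : B k, g (k + 1) (β k b) = g k b)
    -- the direct limits `A∞ = colim A_k` and `B∞ = colim B_k`, encoded via cocone maps
    -- satisfying the usual description of a direct limit of abelian groups
    (Ainf Binf : Type*) [AddCommGroup Ainf] [AddCommGroup Binf]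
    (uA : ∀ k, A k →+ Ainf) (uB : ∀ k, B k →+ Binf)
    (huA : ∀ k, 1 ≤ k → (uA (k + 1)).comp (α k) = uA k)
    (huB : ∀ k, 1 ≤ k → (uB (k + 1)).comp (β k) = uB k)
    (huAsurj : ∀ a : Ainf, ∃ k, 1 ≤ k ∧ ∃ x, uA k x = a)
    (huBsurj : ∀ b : Binf, ∃ k, 1 ≤ k ∧ ∃ x, uB k x = b)
    (huAker : ∀ k, 1 ≤ k → ∀ x : A k, uA k x = 0 → ∃ l, chainMap α k l x = 0)
    (huBker : ∀ k, 1 ≤ k → ∀ x : B k, uB k x = 0 → ∃ l, chainMap β k l x = 0)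
    -- the induced maps of the limit sequence `0 → A∞ → B∞ →g∞→ C[p^∞] → 0`
    (finf : Ainf →+ Binf) (ginf : Binf →+ C)
    (hfinf : ∀ k, 1 ≤ k → finf.comp (uA k) = (uB k).comp (f k))
    (hginf : ∀ k, 1 ≤ k → ginf.comp (uB k) = g k)
    -- the decomposition `colim A_k ≅ D ⊕ M`, `D` divisible, `M` of bounded exponent
    (D M : Type*) [AddCommGroup D] [AddCommGroup M]
    (hD : ∀ m : ℕ, 0 < m → ∀ d : D, ∃ e : D, m • e = d)
    (hM : ∃ m : ℕ, 0 < m ∧ ∀ x : M, m • x = 0)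
    (hdec : Nonempty (Ainf ≃+ D × M)) :
    ∃ s : pPrimarySubgroup p C →+ Binf, ∀ t, ginf (s t) = (t : C) := by
  obtain ⟨φ⟩ := hdec
  have hfinf' : ∀ k, 1 ≤ k → ∀ x, finf (uA k x) = uB k (f k x) := fun k hk x =>
    DFunLike.congr_fun (hfinf k hk) x
  have hginf' : ∀ k, 1 ≤ k → ∀ x, ginf (uB k x) = g k x := fun k hk x =>
    DFunLike.congr_fun (hginf k hk) x
  have hAtors : ∀ a : Ainf, ∃ k : ℕ, p ^ k • a = 0 := by
    intro a
    obtain ⟨k, hk, x, rfl⟩ := huAsurj a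
    exact ⟨k, by rw [← map_nsmul, hA k hk, map_zero]⟩
  have hBtors : ∀ b : Binf, ∃ k : ℕ, p ^ k • b = 0 := by
    intro b
    obtain ⟨k, hk, x, rfl⟩ := huBsurj b
    exact ⟨k, by rw [← map_nsmul, hB k hk, map_zero]⟩
  have hinj : Function.Injective finf := by
    refine (injective_iff_map_eq_zero finf).mpr fun a ha => ?_
    obtain ⟨k, hk, x, rfl⟩ := huAsurj a
    rw [hfinf' k hk] at ha
    obtain ⟨l, hl⟩ := huBker k hk _ ha
    rw [← chainMap_comm hcomm₁ hk] at hl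
    rw [← apply_chainMap huA hk l, (injective_iff_map_eq_zero _).mp (hf (k + l) (by omega)) _ hl,
      map_zero]
  have hgf : ∀ a, ginf (finf a) = 0 := by
    intro a
    obtain ⟨k, hk, x, rfl⟩ := huAsurj a
    rw [hfinf' k hk, hginf' k hk]
    exact (hfg k hk _).mpr ⟨x, rfl⟩
  have hker : ∀ b, ginf b = 0 → ∃ a, finf a = b := by
    intro b hb
    obtain ⟨k, hk, x, rfl⟩ := huBsurj b
    rw [hginf' k hk] at hb
    obtain ⟨a, rfl⟩ := (hfg k hk x).mp hb
    exact ⟨uA k a, hfinf' k hk a⟩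
  have hlift : ∀ (j : ℕ) (c : C), p ^ j • c = 0 → ∃ b, p ^ j • b = 0 ∧ ginf b = c := by
    intro j c hc
    rcases Nat.eq_zero_or_pos j with rfl | hj
    · exact ⟨0, smul_zero _, by simpa using hc.symm⟩
    · obtain ⟨y, rfl⟩ := (hg j hj c).mpr hc
      exact ⟨uB j y, by rw [← map_nsmul, hB j hj, map_zero], hginf' j hj y⟩
  have hpure : ∀ (j : ℕ) (a : Ainf), (∃ b, p ^ j • b = finf a) → ∃ a', p ^ j • a' = a := by
    rintro j a ⟨b, hb⟩
    obtain ⟨b₀, hb₀, hgb₀⟩ := hlift j (ginf b) (by rw [← map_nsmul, hb, hgf])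
    obtain ⟨a', ha'⟩ := hker (b - b₀) (by rw [map_sub, hgb₀, sub_self])
    exact ⟨a', hinj (by rw [map_nsmul, ha', smul_sub, hb₀, sub_zero, hb])⟩
  obtain ⟨n, hn⟩ := exists_stable_of_divisible_prod_bounded hp hAtors hD hM φ
  obtain ⟨r, hr⟩ := exists_retraction_of_pure_of_stable hp hn hBtors finf hinj hpure
  have hsurj : ∀ t : pPrimarySubgroup p C, ∃ b, ginf b = t := by
    rintro ⟨c, k, hk⟩
    obtain ⟨b, -, hb⟩ := hlift k c hk
    exact ⟨b, hb⟩
  choose σ hσ using hsurj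
  have huniq : ∀ b b', ginf b = ginf b' → b - finf (r b) = b' - finf (r b') := by
    intro b b' h
    obtain ⟨a, ha⟩ := hker (b - b') (by rw [map_sub, h, sub_self])
    obtain rfl : b = finf a + b' := by rw [ha, sub_add_cancel]
    rw [map_add, hr, map_add]
    abel
  refine ⟨AddMonoidHom.mk' (fun t => σ t - finf (r (σ t))) fun s t => ?_, fun t => ?_⟩
  · rw [huniq (σ (s + t)) (σ s + σ t) (by simp [hσ]), map_add, map_add]
    abel
  · simp [hσ, hgf]
end

section
/- Let p be a prime and C an abelian group. Suppose given, for every integer k > 0, an exact sequence S_k of ℤ/p^k-modules 0 → A_k → B_k → C[p^k] → 0 and, for every k > 0, a morphism of short exact sequences S_k → S_{k+1} whose right-hand map is the canonical inclusion C[p^k] ↪ C[p^{k+1}]. Assume moreover that the p-primary torsion subgroup C[p^∞] has bounded exponent, i.e. C[p^∞] = C[p^n] for some n. Then the direct limit exact sequence 0 → colim A_k → colim B_k → C[p^∞] → 0 splits. -/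
/-- An injection into an abelian group of prime exponent `p` has a retraction. -/
theorem exists_leftInverse_of_injective_of_prime_nsmul_eq_zero {p : ℕ} (hp : p.Prime)
    {N Q : Type*} [AddCommGroup N] [AddCommGroup Q] (hQ : ∀ x : Q, p • x = 0)
    (i : N →+ Q) (hi : Function.Injective i) :
    ∃ r : Q →+ N, ∀ x, r (i x) = x := by
  have : Fact p.Prime := ⟨hp⟩
  let : Module (ZMod p) Q := AddCommGroup.zmodModule hQ
  let : Module (ZMod p) N := AddCommGroup.zmodModule fun x => hi <| by
    rw [map_nsmul, hQ, map_zero]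
  obtain ⟨r, hr⟩ := (i.toZModLinearMap p).exists_leftInverse_of_injective
    (LinearMap.ker_eq_bot.2 hi)
  exact ⟨r.toAddMonoidHom, LinearMap.congr_fun hr⟩

/-- A surjection `g : K →+ C` of abelian groups has a section if its kernel meets `pK` trivially
for some prime `p`. -/
theorem exists_section_of_ker_inf_nsmul_eq_zero {p : ℕ} (hp : p.Prime)
    {K C : Type*} [AddCommGroup K] [AddCommGroup C] (g : K →+ C)
    (hg : Function.Surjective g) (hker : ∀ b : K, g (p • b) = 0 → p • b = 0) :
    ∃ s : C →+ K, ∀ c, g (s c) = c := by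
  let P : AddSubgroup K := (nsmulAddMonoidHom (α := K) p).range
  obtain ⟨ρ, hρ⟩ := exists_leftInverse_of_injective_of_prime_nsmul_eq_zero hp (Q := K ⧸ P)
    (fun x => by
      induction x using QuotientAddGroup.induction_on with
      | H b =>
        rw [← QuotientAddGroup.mk_nsmul, QuotientAddGroup.eq_zero_iff]
        exact ⟨b, rfl⟩)
    ((QuotientAddGroup.mk' P).comp g.ker.subtype)
    ((injective_iff_map_eq_zero _).2 fun x hx => by
      obtain ⟨b, hb⟩ : (x : K) ∈ P := (QuotientAddGroup.eq_zero_iff _).1 hx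
      replace hb : p • b = x := hb
      ext
      rw [← hb]
      exact hker b (by rw [hb]; exact x.2))
  let q : K →+ K := AddMonoidHom.id K - g.ker.subtype.comp (ρ.comp (QuotientAddGroup.mk' P))
  have hgq (b : K) : g (q b) = g b := by
    change g (b - (ρ b : K)) = g b
    rw [map_sub, (ρ b).2, sub_zero]
  have hq : g.ker ≤ q.ker := by
    intro b hb
    change b - (ρ b : K) = 0
    rw [show ρ b = ⟨b, hb⟩ from hρ ⟨b, hb⟩, sub_self]
  let e := QuotientAddGroup.quotientKerEquivOfSurjective g hg
  refine ⟨(QuotientAddGroup.lift g.ker q hq).comp e.symm.toAddMonoidHom, fun c => ?_⟩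
  obtain ⟨b, rfl⟩ := hg c
  have : e.symm (g b) = (b : K ⧸ g.ker) := e.symm_apply_eq.2 rfl
  change g (QuotientAddGroup.lift g.ker q hq (e.symm (g b))) = g b
  rw [this]
  exact hgq b

/-- A homomorphism onto an abelian group of exponent `p ^ n` has a section if every element killed
by `p ^ k` lifts to an element killed by `p ^ k`. -/
theorem exists_section_of_lift_torsion {p : ℕ} (hp : p.Prime) (n : ℕ)
    {B C : Type*} [AddCommGroup B] [AddCommGroup C] (g : B →+ C)
    (hC : ∀ c : C, p ^ n • c = 0)
    (hg : ∀ (k : ℕ) (c : C), p ^ k • c = 0 → ∃ b : B, p ^ k • b = 0 ∧ g b = c) :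
    ∃ s : C →+ B, ∀ c, g (s c) = c := by
  induction n generalizing B C with
  | zero => exact ⟨0, fun c => by simpa using (hC c).symm⟩
  | succ n ih =>
    let PB : AddSubgroup B := (nsmulAddMonoidHom (α := B) p).range
    let PC : AddSubgroup C := (nsmulAddMonoidHom (α := C) p).range
    let g' : PB →+ PC := (g.comp PB.subtype).codRestrict PC (by
      rintro ⟨_, b, rfl⟩
      exact ⟨g b, (map_nsmul g p b).symm⟩)
    obtain ⟨s, hs⟩ := ih g'
      (by
        rintro ⟨_, c, rfl⟩
        ext
        change p ^ n • p • c = 0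
        rw [← mul_smul, ← pow_succ, hC])
      (by
        rintro k ⟨_, c, rfl⟩ hc
        have hc' : p ^ k • p • c = 0 := congrArg Subtype.val hc
        rw [← mul_smul, ← pow_succ] at hc'
        obtain ⟨b, hb, rfl⟩ := hg _ _ hc'
        refine ⟨⟨p • b, b, rfl⟩, ?_, ?_⟩
        · ext
          change p ^ k • p • b = 0
          rw [← mul_smul, ← pow_succ, hb]
        · ext
          exact map_nsmul g p b)
    have hs' (x : PC) : g (s x) = x := congrArg Subtype.val (hs x)
    let m : C →+ B := PB.subtype.comp (s.comp (nsmulAddMonoidHom (α := C) p).rangeRestrict)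
    have hm (c : C) : g (m c) = p • c := hs' _
    let K : AddSubgroup B := (nsmulAddMonoidHom (α := B) p - m.comp g).ker
    have hK (b : B) : b ∈ K ↔ p • b = m (g b) := sub_eq_zero
    obtain ⟨t, ht⟩ := exists_section_of_ker_inf_nsmul_eq_zero hp (g.comp K.subtype)
      (by
        intro c
        obtain ⟨b, hb⟩ : m c ∈ PB := (s _).2
        replace hb : p • b = m c := hb
        obtain ⟨d, hd, hgd⟩ := hg 1 (g b - c) (by
          rw [pow_one, smul_sub, ← map_nsmul, hb, hm, sub_self])
        have hgbd : g (b - d) = c := by rw [map_sub, hgd, sub_sub_cancel]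
        refine ⟨⟨b - d, (hK _).2 ?_⟩, hgbd⟩
        rw [hgbd, smul_sub, hb, ← pow_one p, hd, sub_zero])
      (by
        rintro ⟨b, hb⟩ h
        ext
        change p • b = 0
        replace h : g (p • b) = 0 := h
        have hx : (nsmulAddMonoidHom (α := C) p).rangeRestrict (g b) = 0 := by
          ext
          change p • g b = 0
          rw [← map_nsmul, h]
        rw [(hK b).1 hb]
        change ((s ((nsmulAddMonoidHom (α := C) p).rangeRestrict (g b)) : PB) : B) = 0
        rw [hx, map_zero, AddSubgroup.coe_zero])
    exact ⟨K.subtype.comp t, ht⟩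


/-- Let `p` be a prime and `C` an abelian group. Suppose given, for every `k ≥ 1`, an exact
sequence `S_k` of `ℤ/p^k`-modules `0 → A_k → B_k → C[p^k] → 0` and morphisms of short exact
sequences `S_k → S_{k+1}` whose right-hand maps are the canonical inclusions
`C[p^k] ↪ C[p^{k+1}]`. If the `p`-primary torsion subgroup `C[p^∞]` has bounded exponent
(i.e. `C[p^∞] = C[p^n]` for some `n`), then the direct limit exact sequence
`0 → colim A_k → colim B_k → C[p^∞] → 0` splits. -/
theorem direct_limit_splits_of_bounded_exponent
    (p : ℕ) (hp : p.Prime)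
    (C : Type*) [AddCommGroup C]
    (A B : ℕ → Type*) [∀ k, AddCommGroup (A k)] [∀ k, AddCommGroup (B k)]
    (f : ∀ k, A k →+ B k) (g : ∀ k, B k →+ C)
    -- `A_k` and `B_k` are `ℤ/p^k`-modules, i.e. killed by `p^k`
    (hA : ∀ k, 1 ≤ k → ∀ a : A k, p ^ k • a = 0)
    (hB : ∀ k, 1 ≤ k → ∀ b : B k, p ^ k • b = 0)
    -- exactness of `S_k` : `0 → A_k → B_k → C[p^k] → 0`
    (hf : ∀ k, 1 ≤ k → Function.Injective (f k))
    (hfg : ∀ k, 1 ≤ k → ∀ b : B k, g k b = 0 ↔ ∃ a : A k, f k a = b)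
    (hg : ∀ k, 1 ≤ k → ∀ c : C, (∃ b : B k, g k b = c) ↔ p ^ k • c = 0)
    -- the morphisms of short exact sequences `S_k → S_{k+1}`; the right-hand vertical
    -- map being the inclusion `C[p^k] ↪ C[p^{k+1}]` is encoded by `g (k+1) ∘ β k = g k`
    (α : ∀ k, A k →+ A (k + 1)) (β : ∀ k, B k →+ B (k + 1))
    (hcomm₁ : ∀ k, 1 ≤ k → ∀ a : A k, f (k + 1) (α k a) = β k (f k a))
    (hcomm₂ : ∀ k, 1 ≤ k → ∀ b : B k, g (k + 1) (β k b) = g k b)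
    -- the direct limits `A∞ = colim A_k` and `B∞ = colim B_k`, encoded via cocone maps
    -- satisfying the usual description of a direct limit of abelian groups
    (Ainf Binf : Type*) [AddCommGroup Ainf] [AddCommGroup Binf]
    (uA : ∀ k, A k →+ Ainf) (uB : ∀ k, B k →+ Binf)
    (huA : ∀ k, 1 ≤ k → (uA (k + 1)).comp (α k) = uA k)
    (huB : ∀ k, 1 ≤ k → (uB (k + 1)).comp (β k) = uB k)
    (huAsurj : ∀ a : Ainf, ∃ k, 1 ≤ k ∧ ∃ x, uA k x = a)
    (huBsurj : ∀ b : Binf, ∃ k, 1 ≤ k ∧ ∃ x, uB k x = b)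
    (huAker : ∀ k, 1 ≤ k → ∀ x : A k, uA k x = 0 → ∃ l, chainMap α k l x = 0)
    (huBker : ∀ k, 1 ≤ k → ∀ x : B k, uB k x = 0 → ∃ l, chainMap β k l x = 0)
    -- the induced maps of the limit sequence `0 → A∞ → B∞ →g∞→ C[p^∞] → 0`
    (finf : Ainf →+ Binf) (ginf : Binf →+ C)
    (hfinf : ∀ k, 1 ≤ k → finf.comp (uA k) = (uB k).comp (f k))
    (hginf : ∀ k, 1 ≤ k → ginf.comp (uB k) = g k)
    -- `C[p^∞]` is torsion of bounded exponent: `C[p^∞] = C[p^n]` for some `n`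
    (hbound : ∃ n : ℕ, ∀ c : C, (∃ k : ℕ, p ^ k • c = 0) → p ^ n • c = 0) :
    ∃ s : pPrimarySubgroup p C →+ Binf, ∀ t, ginf (s t) = (t : C) := by
  obtain ⟨n, hn⟩ := hbound
  have hgB (k : ℕ) (hk : 1 ≤ k) (x : B k) : ginf (uB k x) = g k x :=
    DFunLike.congr_fun (hginf k hk) x
  have hmem (b : Binf) : ginf b ∈ pPrimarySubgroup p C := by
    obtain ⟨k, hk, x, rfl⟩ := huBsurj b
    exact ⟨k, (hg k hk _).1 ⟨x, (hgB k hk x).symm⟩⟩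
  obtain ⟨s, hs⟩ := exists_section_of_lift_torsion hp n
    (ginf.codRestrict (pPrimarySubgroup p C) hmem)
    (fun c => Subtype.ext (hn c c.2))
    (by
      intro k c hc
      rcases Nat.eq_zero_or_pos k with rfl | hk
      · refine ⟨0, smul_zero _, ?_⟩
        rw [map_zero, ← hc, pow_zero, one_smul]
      · obtain ⟨x, hx⟩ := (hg k hk c).2 (congrArg Subtype.val hc)
        refine ⟨uB k x, ?_, Subtype.ext ((hgB k hk x).trans hx)⟩
        rw [← map_nsmul, hB k hk, map_zero])
  exact ⟨s, fun t => congrArg Subtype.val (hs t)⟩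
end

section
/- Fix a prime p and an integer n ≥ 1. For every group-homomorphism section s : C_{n+1} → B_{n+1} of g_{n+1} (i.e. g_{n+1} ∘ s = id), the image s(η_n(C_n)) is not contained in ψ_n(B_n). In particular, there is no pair of sections s_n : C_n → B_n of g_n and s_{n+1} : C_{n+1} → B_{n+1} of g_{n+1} satisfying ψ_n ∘ s_n = s_{n+1} ∘ η_n, i.e. there is no compatible family of sections for this system. -/
/-- `B_n := ∏_{k=1}^n ℤ/p^k`, indexed by `k : Fin n` (so the `k`-th factor is
`ℤ/p^(k+1)`, `k = 0, ..., n-1`). -/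
abbrev Bgrp (p n : ℕ) : Type := ∀ k : Fin n, ZMod (p ^ (k.1 + 1))

/-- The additive map `ℤ/p^k →+ ℤ/p^n` (for `k = j+1 ≤ n`) sending
`x + p^kℤ` to `p^{n-k}·x + p^nℤ`. -/
noncomputable def transferComponent (p n : ℕ) (k : Fin n) :
    ZMod (p ^ (k.1 + 1)) →+ ZMod (p ^ n) :=
  ZMod.lift (p ^ (k.1 + 1))
    ⟨(Int.castAddHom (ZMod (p ^ n))).comp (AddMonoidHom.mulLeft ((p : ℤ) ^ (n - (k.1 + 1)))),
      by
        have hk : k.1 + 1 ≤ n := k.2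
        show ((((p : ℤ) ^ (n - (k.1 + 1))) * ((p ^ (k.1 + 1) : ℕ) : ℤ) : ℤ) : ZMod (p ^ n)) = 0
        push_cast
        rw [← pow_add, Nat.sub_add_cancel hk]
        exact_mod_cast ZMod.natCast_self (p ^ n)⟩

/-- The homomorphism `g_n : B_n →+ C_n := ℤ/p^n`,
`g_n((x_k + p^kℤ)_{1≤k≤n}) = Σ_{k=1}^n p^{n-k} x_k + p^nℤ`. -/
noncomputable def gmap (p n : ℕ) : Bgrp p n →+ ZMod (p ^ n) :=
  ∑ k : Fin n, (transferComponent p n k).comp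
    (Pi.evalAddMonoidHom (fun k : Fin n => ZMod (p ^ (k.1 + 1))) k)

/-- `ψ_n : B_n →+ B_{n+1}`, `ψ_n(x) = (x, 0)` (appending a zero coordinate). -/
def psi (p n : ℕ) : Bgrp p n →+ Bgrp p (n + 1) :=
  AddMonoidHom.mk' (fun x k => if h : k.1 < n then x ⟨k.1, h⟩ else 0)
    (by
      intro a b
      funext k
      by_cases h : k.1 < n <;> simp [h])

/-- `η_n : C_n →+ C_{n+1}`, `η_n(x + p^nℤ) = p·x + p^{n+1}ℤ`. -/
noncomputable def eta (p n : ℕ) : ZMod (p ^ n) →+ ZMod (p ^ (n + 1)) :=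
  ZMod.lift (p ^ n)
    ⟨(Int.castAddHom (ZMod (p ^ (n + 1)))).comp (AddMonoidHom.mulLeft (p : ℤ)),
      by
        show (((p : ℤ) * ((p ^ n : ℕ) : ℤ) : ℤ) : ZMod (p ^ (n + 1))) = 0
        push_cast
        rw [← pow_succ']
        exact_mod_cast ZMod.natCast_self (p ^ (n + 1))⟩


theorem eta_one (p n : ℕ) : eta p n 1 = p • 1 := by
  rw [← Int.cast_one (R := ZMod (p ^ n)), eta, ZMod.lift_coe]
  simp

theorem psi_apply_last (p n : ℕ) (x : Bgrp p n) : psi p n x (Fin.last n) = 0 := by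
  simp [psi]

/-- If `p • b` lies in the image of `ψ_n`, then `p ^ n` annihilates `b`. -/
theorem pow_nsmul_eq_zero {p n : ℕ} (hn : 1 ≤ n) {b : Bgrp p (n + 1)}
    (hb : p • b ∈ Set.range (psi p n)) : p ^ n • b = 0 := by
  obtain ⟨x, hx⟩ := hb
  funext k
  rw [Pi.smul_apply, Pi.zero_apply]
  rcases Fin.eq_castSucc_or_eq_last k with ⟨j, rfl⟩ | rfl
  · rw [nsmul_eq_mul, (ZMod.natCast_eq_zero_iff _ _).2 (pow_dvd_pow p j.2), zero_mul]
  · have hlast : p • b (Fin.last n) = 0 := by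
      rw [← Pi.smul_apply, ← hx, psi_apply_last]
    obtain ⟨c, hc⟩ := dvd_pow_self p (Nat.one_le_iff_ne_zero.1 hn)
    rw [hc, mul_nsmul, hlast, nsmul_zero]

theorem not_range_subset {p n : ℕ} (hp : p.Prime) (hn : 1 ≤ n)
    (s : ZMod (p ^ (n + 1)) →+ Bgrp p (n + 1)) (hs : ∀ c, gmap p (n + 1) (s c) = c) :
    ¬ (Set.range (fun c : ZMod (p ^ n) => s (eta p n c)) ⊆ Set.range (psi p n)) := by
  intro h
  have hb : p • s 1 ∈ Set.range (psi p n) := by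
    rw [← map_nsmul, ← eta_one]
    exact h ⟨1, rfl⟩
  have h0 : p ^ n • (1 : ZMod (p ^ (n + 1))) = 0 := by
    rw [← hs (p ^ n • 1), map_nsmul, pow_nsmul_eq_zero hn hb, map_zero]
  rw [nsmul_one, ZMod.natCast_eq_zero_iff, Nat.pow_dvd_pow_iff_le_right hp.one_lt] at h0
  lia

/-- For every group-homomorphism section `s` of `g_{n+1}`, the image `s(η_n(C_n))` is not
contained in `ψ_n(B_n)`; in particular there is no pair of sections `s_n` of `g_n` and
`s_{n+1}` of `g_{n+1}` with `ψ_n ∘ s_n = s_{n+1} ∘ η_n`, i.e. no compatible family of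
sections for this system. -/
theorem no_compatible_sections (p : ℕ) (hp : p.Prime) (n : ℕ) (hn : 1 ≤ n) :
    (∀ s : ZMod (p ^ (n + 1)) →+ Bgrp p (n + 1),
      (∀ c, gmap p (n + 1) (s c) = c) →
      ¬ (Set.range (fun c : ZMod (p ^ n) => s (eta p n c)) ⊆ Set.range (psi p n))) ∧
    ¬ ∃ (s₁ : ZMod (p ^ n) →+ Bgrp p n) (s₂ : ZMod (p ^ (n + 1)) →+ Bgrp p (n + 1)),
        (∀ c, gmap p n (s₁ c) = c) ∧ (∀ c, gmap p (n + 1) (s₂ c) = c) ∧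
        (psi p n).comp s₁ = s₂.comp (eta p n) := by
  refine ⟨not_range_subset hp hn, ?_⟩
  rintro ⟨s₁, s₂, -, hs₂, h⟩
  refine not_range_subset hp hn s₂ hs₂ ?_
  rintro _ ⟨c, rfl⟩
  exact ⟨s₁ c, DFunLike.congr_fun h c⟩
end

section
/- Fix a prime p. Let B_∞ := colim(B_n, ψ_n), C_∞ := colim(C_n, η_n), and let g_∞ : B_∞ → C_∞ be the homomorphism induced by the g_n. Then: (i) every element of C_∞ is divisible by p (C_∞ is p-divisible, and in fact nonzero elements infinitely divisible by p exist in C_∞); (ii) no nonzero element of B_∞ is divisible by p^k for every k ≥ 1. Consequently, the surjection g_∞ admits no group-homomorphism section. -/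
/-- Transition map `B_n →+ B_{n+l}` obtained by composing the maps `ψ`. -/
noncomputable def psiChain (p : ℕ) : ∀ (n l : ℕ), Bgrp p n →+ Bgrp p (n + l)
  | _, 0 => AddMonoidHom.id _
  | n, l + 1 => (psi p (n + l)).comp (psiChain p n l)

/-- Transition map `C_n →+ C_{n+l}` obtained by composing the maps `η`. -/
noncomputable def etaChain (p : ℕ) : ∀ (n l : ℕ), ZMod (p ^ n) →+ ZMod (p ^ (n + l))
  | _, 0 => AddMonoidHom.id _
  | n, l + 1 => (eta p (n + l)).comp (etaChain p n l)

theorem eta_intCast (p n : ℕ) (m : ℤ) :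
    eta p n (m : ZMod (p ^ n)) = ((p * m : ℤ) : ZMod (p ^ (n + 1))) := by
  rw [eta, ZMod.lift_coe]
  rfl

theorem etaChain_intCast (p n l : ℕ) (m : ℤ) :
    etaChain p n l (m : ZMod (p ^ n)) = ((p ^ l * m : ℤ) : ZMod (p ^ (n + l))) := by
  induction l with
  | zero => simp [etaChain]
  | succ l ih =>
    change eta p (n + l) (etaChain p n l m) = _
    rw [ih, eta_intCast, ← mul_assoc, ← pow_succ']

theorem etaChain_one_ne_zero {p : ℕ} (hp : p.Prime) (l : ℕ) :
    etaChain p 1 l 1 ≠ 0 := by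
  intro h
  have hcast := etaChain_intCast p 1 l 1
  rw [Int.cast_one, h, eq_comm, ZMod.intCast_zmod_eq_zero_iff_dvd] at hcast
  have hdvd : p ^ (1 + l) ∣ p ^ l := by
    rw [mul_one] at hcast
    exact_mod_cast hcast
  have := (Nat.pow_dvd_pow_iff_le_right hp.one_lt).mp hdvd
  omega

theorem psi_injective (p n : ℕ) : Function.Injective (psi p n) := by
  intro x y h
  funext k
  simpa [psi] using congrFun h k.castSucc

theorem psiChain_injective (p n l : ℕ) : Function.Injective (psiChain p n l) := by
  induction l with
  | zero => exact Function.injective_id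
  | succ l ih => exact (psi_injective p (n + l)).comp ih

/-- Every element of `B_n` has the same image under the cocone as its extension by zero
to any later stage. -/
theorem exists_zero_extension {p : ℕ} {M : Type*} [AddCommGroup M] {u : ∀ n, Bgrp p n →+ M}
    (hu : ∀ n, 1 ≤ n → (u (n + 1)).comp (psi p n) = u n) {n N : ℕ} (hn : 1 ≤ n)
    (hnN : n ≤ N) (x : Bgrp p n) :
    ∃ x' : Bgrp p N, u N x' = u n x ∧ ∀ (k : Fin n), x' (k.castLE hnN) = x k := by
  induction N, hnN using Nat.le_induction with
  | base => exact ⟨x, rfl, fun _ => rfl⟩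
  | succ N hnN ih =>
    obtain ⟨x', hx', hk⟩ := ih
    refine ⟨psi p N x', (DFunLike.congr_fun (hu N (hn.trans hnN)) x').trans hx', fun k => ?_⟩
    rw [← hk k]
    exact dif_pos (k.2.trans_le hnN)

theorem pow_nsmul_zmod_eq_zero {p k n : ℕ} (h : k ≤ n) (x : ZMod (p ^ k)) :
    p ^ n • x = 0 := by
  rw [nsmul_eq_mul, (ZMod.natCast_eq_zero_iff _ _).mpr (pow_dvd_pow p h), zero_mul]

/-- Let `B∞ = colim (B_n, ψ_n)` and `C∞ = colim (C_n, η_n)` (encoded below via cocone maps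
`u_n : B_n →+ B∞`, `v_n : C_n →+ C∞` satisfying the usual description of a direct limit of
abelian groups: compatibility, joint surjectivity, and elements vanishing in the limit
vanish at some finite stage), and let `g∞ : B∞ →+ C∞` be the homomorphism induced by the
`g_n`. Then: (i) every element of `C∞` is divisible by `p`, and there is a nonzero element
of `C∞` divisible by `p^k` for every `k`; (ii) no nonzero element of `B∞` is divisible by
`p^k` for every `k ≥ 1`. Consequently, the surjection `g∞` admits no group-homomorphism
section. -/
theorem no_section_in_the_limit (p : ℕ) (hp : p.Prime)
    (Binf Cinf : Type*) [AddCommGroup Binf] [AddCommGroup Cinf]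
    (u : ∀ n, Bgrp p n →+ Binf) (v : ∀ n, ZMod (p ^ n) →+ Cinf)
    (hu : ∀ n, 1 ≤ n → (u (n + 1)).comp (psi p n) = u n)
    (hv : ∀ n, 1 ≤ n → (v (n + 1)).comp (eta p n) = v n)
    (husurj : ∀ b : Binf, ∃ n, 1 ≤ n ∧ ∃ x, u n x = b)
    (hvsurj : ∀ c : Cinf, ∃ n, 1 ≤ n ∧ ∃ x, v n x = c)
    (huker : ∀ n, 1 ≤ n → ∀ x : Bgrp p n, u n x = 0 → ∃ l, psiChain p n l x = 0)
    (hvker : ∀ n, 1 ≤ n → ∀ x : ZMod (p ^ n), v n x = 0 → ∃ l, etaChain p n l x = 0)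
    (ginf : Binf →+ Cinf)
    (hginf : ∀ n, 1 ≤ n → ginf.comp (u n) = (v n).comp (gmap p n)) :
    (∀ c : Cinf, ∃ d : Cinf, p • d = c) ∧
    (∃ c : Cinf, c ≠ 0 ∧ ∀ k : ℕ, ∃ d : Cinf, p ^ k • d = c) ∧
    (∀ b : Binf, (∀ k : ℕ, ∃ y : Binf, p ^ k • y = b) → b = 0) ∧
    ¬ ∃ s : Cinf →+ Binf, ∀ c : Cinf, ginf (s c) = c := by
  have hdiv : ∀ c : Cinf, ∃ d : Cinf, p • d = c := by
    intro c
    obtain ⟨n, hn, x, rfl⟩ := hvsurj c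
    obtain ⟨m, rfl⟩ := ZMod.intCast_surjective x
    refine ⟨v (n + 1) (m : ZMod (p ^ (n + 1))), ?_⟩
    rw [← hv n hn, AddMonoidHom.comp_apply, eta_intCast, ← map_nsmul]
    simp
  have hdivpow : ∀ (k : ℕ) (c : Cinf), ∃ d : Cinf, p ^ k • d = c := by
    intro k
    induction k with
    | zero => exact fun c => ⟨c, by simp⟩
    | succ k ih =>
      intro c
      obtain ⟨d, rfl⟩ := ih c
      obtain ⟨e, rfl⟩ := hdiv d
      exact ⟨e, by rw [pow_succ, mul_nsmul']⟩
  have hne : v 1 1 ≠ 0 := by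
    intro h
    obtain ⟨l, hl⟩ := hvker 1 le_rfl 1 h
    exact etaChain_one_ne_zero hp l hl
  have hred : ∀ b : Binf, (∀ k : ℕ, ∃ y : Binf, p ^ k • y = b) → b = 0 := by
    intro b hb
    obtain ⟨n, hn, x, rfl⟩ := husurj b
    obtain ⟨y, hy⟩ := hb n
    obtain ⟨m, hm, z, rfl⟩ := husurj y
    obtain ⟨x', hx', hxk⟩ := exists_zero_extension hu hn (le_max_left n m) x
    obtain ⟨z', hz', -⟩ := exists_zero_extension hu hm (le_max_right n m) z
    have hzero : u (max n m) (p ^ n • z' - x') = 0 := by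
      rw [map_sub, map_nsmul, hz', hx', hy, sub_self]
    obtain ⟨l, hl⟩ := huker _ (hn.trans (le_max_left n m)) _ hzero
    have heq : p ^ n • z' = x' :=
      sub_eq_zero.mp (psiChain_injective p _ l (hl.trans (map_zero _).symm))
    have hx : x = 0 := by
      funext k
      rw [← hxk k, ← heq]
      exact pow_nsmul_zmod_eq_zero (Nat.succ_le_of_lt k.2) _
    rw [hx, map_zero]
  refine ⟨hdiv, ⟨v 1 1, hne, fun k => hdivpow k _⟩, hred, ?_⟩
  rintro ⟨s, hs⟩
  apply hne
  rw [← hs (v 1 1), hred (s (v 1 1)), map_zero]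
  intro k
  obtain ⟨d, hd⟩ := hdivpow k (v 1 1)
  exact ⟨s d, by rw [← map_nsmul, hd]⟩
end

section
/- Fix a prime p, and let 0 → A_∞ → B_∞ →^{g_∞} C_∞ → 0 be the direct limit of the short exact sequences 0 → A_n → B_n →^{g_n} C_n → 0 along the maps (φ_n, ψ_n, η_n). This limit sequence is a pure exact sequence of abelian groups that does not split. In particular, there exists a pure exact sequence of abelian groups which is not split. -/
/-- A pure exact sequence of abelian groups `0 → A → B →g→ C → 0` which does not split. -/
structure PureExactNonSplitSequence : Type 1 where
  A : Type
  B : Type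
  C : Type
  [instA : AddCommGroup A]
  [instB : AddCommGroup B]
  [instC : AddCommGroup C]
  f : A →+ B
  g : B →+ C
  inj : Function.Injective f
  exact : ∀ b : B, g b = 0 ↔ ∃ a : A, f a = b
  surj : Function.Surjective g
  pure : ∀ c : C, ∃ b : B, g b = c ∧ addOrderOf b = addOrderOf c
  nonsplit : ¬ ∃ s : C →+ B, ∀ c : C, g (s c) = c

theorem eta_injective {p : ℕ} (hp : p ≠ 0) (n : ℕ) : Function.Injective (eta p n) := by
  rw [injective_iff_map_eq_zero]
  intro x hx
  obtain ⟨m, rfl⟩ := ZMod.intCast_surjective x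
  rw [eta_intCast, ZMod.intCast_zmod_eq_zero_iff_dvd] at hx
  rw [ZMod.intCast_zmod_eq_zero_iff_dvd]
  push_cast [pow_succ'] at hx ⊢
  exact Int.dvd_of_mul_dvd_mul_left (by exact_mod_cast hp) hx

theorem etaChain_injective {p : ℕ} (hp : p ≠ 0) (n l : ℕ) :
    Function.Injective (etaChain p n l) := by
  induction l with
  | zero => exact Function.injective_id
  | succ l ih => exact (eta_injective hp (n + l)).comp ih

theorem gmap_apply (p n : ℕ) (x : Bgrp p n) :
    gmap p n x = ∑ k, transferComponent p n k (x k) := by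
  simp [gmap]

theorem transferComponent_last (p n : ℕ) (m : ℤ) :
    transferComponent p (n + 1) (Fin.last n) (m : ZMod (p ^ (n + 1))) = m := by
  refine (ZMod.lift_coe (p ^ (n + 1)) _ m).trans ?_
  simp

theorem gmap_single_last (p n : ℕ) (c : ZMod (p ^ (n + 1))) :
    gmap p (n + 1) (Pi.single (Fin.last n) c) = c := by
  rw [gmap_apply, Finset.sum_eq_single (Fin.last n)]
  · obtain ⟨m, rfl⟩ := ZMod.intCast_surjective c
    rw [Pi.single_eq_same]
    exact transferComponent_last p n m
  · intro k _ hk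
    rw [Pi.single_eq_of_ne hk, map_zero]
  · simp

/-- Every element of a finite stage can be moved to a later stage without changing its
coordinates or its image in the limit. -/
theorem exists_extension {p : ℕ} {B : Type*} [AddCommGroup B] (u : ∀ n, Bgrp p n →+ B)
    (hu : ∀ n, 1 ≤ n → (u (n + 1)).comp (psi p n) = u n) {n : ℕ} (hn : 1 ≤ n)
    (x : Bgrp p n) {N : ℕ} (hN : n ≤ N) :
    ∃ y : Bgrp p N, u N y = u n x ∧
      ∀ k : Fin n, y ⟨k.1, k.2.trans_le hN⟩ = x k := by
  induction N, hN using Nat.le_induction with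
  | base => exact ⟨x, rfl, fun _ => rfl⟩
  | succ N hN ih =>
    obtain ⟨y, hy, hyx⟩ := ih
    refine ⟨psi p N y, ?_, fun k => ?_⟩
    · rw [← hy]
      exact DFunLike.congr_fun (hu N (hn.trans hN)) y
    · rw [← hyx k]
      simp [psi, k.2.trans_le hN]

theorem pow_nsmul_apply_one {p : ℕ} {C : Type*} [AddCommGroup C] (v : ∀ n, ZMod (p ^ n) →+ C)
    (hv : ∀ n, 1 ≤ n → (v (n + 1)).comp (eta p n) = v n) (k : ℕ) :
    p ^ k • v (k + 1) 1 = v 1 1 := by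
  induction k with
  | zero => simp
  | succ k ih =>
    have h : p • v (k + 1 + 1) 1 = v (k + 1) 1 := by
      rw [← hv (k + 1) (by simp), AddMonoidHom.comp_apply, ← map_nsmul]
      congr 1
      simpa using (eta_intCast p (k + 1) 1).symm
    rw [pow_succ, mul_smul, h, ih]

/-- An element of the limit that is divisible by every power of `p` vanishes. -/
theorem eq_zero_of_forall_pow_dvd {p : ℕ} {B : Type*} [AddCommGroup B]
    (u : ∀ n, Bgrp p n →+ B)
    (hu : ∀ n, 1 ≤ n → (u (n + 1)).comp (psi p n) = u n)
    (husurj : ∀ b : B, ∃ n, 1 ≤ n ∧ ∃ x, u n x = b)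
    (hinj : ∀ n, 1 ≤ n → Function.Injective (u n))
    (b : B) (hb : ∀ k : ℕ, ∃ d, p ^ k • d = b) : b = 0 := by
  obtain ⟨n, hn, x, rfl⟩ := husurj b
  obtain ⟨d, hd⟩ := hb n
  obtain ⟨m, hm, y, rfl⟩ := husurj d
  obtain ⟨x', hx', hxx'⟩ := exists_extension u hu hn x (le_max_left n m)
  obtain ⟨y', hy', -⟩ := exists_extension u hu hm y (le_max_right n m)
  have h : p ^ n • y' = x' := hinj _ (hn.trans (le_max_left n m)) <| by
    rw [map_nsmul, hy', hx', hd]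
  suffices x = 0 by rw [this, map_zero]
  funext k
  rw [← hxx' k, ← h, Pi.smul_apply, nsmul_eq_mul, Pi.zero_apply,
    (ZMod.natCast_eq_zero_iff _ _).2 (pow_dvd_pow p k.2), zero_mul]

/-- A pure exact nonsplit sequence of small groups can be realised in `Type`. -/
theorem nonempty_pureExactNonSplitSequence {A B C : Type*}
    [AddCommGroup A] [AddCommGroup B] [AddCommGroup C]
    [Small.{0} A] [Small.{0} B] [Small.{0} C] (f : A →+ B) (g : B →+ C)
    (inj : Function.Injective f) (exact : ∀ b : B, g b = 0 ↔ ∃ a : A, f a = b)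
    (surj : Function.Surjective g)
    (pure : ∀ c : C, ∃ b : B, g b = c ∧ addOrderOf b = addOrderOf c)
    (nonsplit : ¬ ∃ s : C →+ B, ∀ c : C, g (s c) = c) :
    Nonempty PureExactNonSplitSequence := by
  let eA : Shrink.{0} A ≃+ A := Shrink.addEquiv
  let eB : Shrink.{0} B ≃+ B := Shrink.addEquiv
  let eC : Shrink.{0} C ≃+ C := Shrink.addEquiv
  refine ⟨{
    A := Shrink.{0} A
    B := Shrink.{0} B
    C := Shrink.{0} C
    f := (eB.symm.toAddMonoidHom.comp f).comp eA.toAddMonoidHom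
    g := (eC.symm.toAddMonoidHom.comp g).comp eB.toAddMonoidHom
    inj := (eB.symm.injective.comp inj).comp eA.injective
    exact := fun b => ?_
    surj := (eC.symm.surjective.comp surj).comp eB.surjective
    pure := fun c => ?_
    nonsplit := ?_ }⟩
  · change eC.symm (g (eB b)) = 0 ↔ ∃ a, eB.symm (f (eA a)) = b
    rw [EmbeddingLike.map_eq_zero_iff, exact, eA.surjective.exists]
    simp only [AddEquiv.symm_apply_eq]
  · obtain ⟨b, hb, ho⟩ := pure (eC c)
    refine ⟨eB.symm b, ?_, ?_⟩
    · change eC.symm (g (eB (eB.symm b))) = c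
      simp [hb]
    · rw [AddEquiv.addOrderOf_eq, ho, AddEquiv.addOrderOf_eq]
  · rintro ⟨s, hs⟩
    refine nonsplit ⟨(eB.toAddMonoidHom.comp s).comp eC.symm.toAddMonoidHom, fun c => ?_⟩
    exact eC.symm.injective (hs (eC.symm c))

/-- Let `0 → A∞ → B∞ →g∞→ C∞ → 0` be the direct limit of the short exact sequences
`0 → A_n → B_n →g_n→ C_n → 0` (with `A_n := ker g_n`) along the maps `(φ_n, ψ_n, η_n)`
(the direct limits being encoded below via cocone maps satisfying the usual description
of a direct limit of abelian groups). This limit sequence is a pure exact sequence of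
abelian groups that does not split. In particular, there exists a pure exact sequence of
abelian groups which is not split. -/
theorem limit_sequence_pure_exact_not_split (p : ℕ) (hp : p.Prime)
    (Ainf Binf Cinf : Type*) [AddCommGroup Ainf] [AddCommGroup Binf] [AddCommGroup Cinf]
    (uA : ∀ n, AddMonoidHom.ker (gmap p n) →+ Ainf)
    (u : ∀ n, Bgrp p n →+ Binf) (v : ∀ n, ZMod (p ^ n) →+ Cinf)
    -- compatibility with `φ_n` (the restriction of `ψ_n` to the kernels), `ψ_n`, `η_n`
    (huA : ∀ n, 1 ≤ n → ∀ (x : Bgrp p n) (hx : gmap p n x = 0)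
      (hx' : gmap p (n + 1) (psi p n x) = 0),
      uA (n + 1) ⟨psi p n x, hx'⟩ = uA n ⟨x, hx⟩)
    (hu : ∀ n, 1 ≤ n → (u (n + 1)).comp (psi p n) = u n)
    (hv : ∀ n, 1 ≤ n → (v (n + 1)).comp (eta p n) = v n)
    -- joint surjectivity
    (huAsurj : ∀ a : Ainf, ∃ n, 1 ≤ n ∧ ∃ x, uA n x = a)
    (husurj : ∀ b : Binf, ∃ n, 1 ≤ n ∧ ∃ x, u n x = b)
    (hvsurj : ∀ c : Cinf, ∃ n, 1 ≤ n ∧ ∃ x, v n x = c)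
    -- vanishing in the limit implies vanishing at a finite stage
    (huAker : ∀ n, 1 ≤ n → ∀ x : AddMonoidHom.ker (gmap p n),
      uA n x = 0 → ∃ l, psiChain p n l (x : Bgrp p n) = 0)
    (huker : ∀ n, 1 ≤ n → ∀ x : Bgrp p n, u n x = 0 → ∃ l, psiChain p n l x = 0)
    (hvker : ∀ n, 1 ≤ n → ∀ x : ZMod (p ^ n), v n x = 0 → ∃ l, etaChain p n l x = 0)
    -- the induced maps of the limit sequence `0 → A∞ → B∞ →g∞→ C∞ → 0`
    (finf : Ainf →+ Binf) (ginf : Binf →+ Cinf)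
    (hfinf : ∀ n, 1 ≤ n →
      finf.comp (uA n) = (u n).comp (AddMonoidHom.ker (gmap p n)).subtype)
    (hginf : ∀ n, 1 ≤ n → ginf.comp (u n) = (v n).comp (gmap p n)) :
    -- the limit sequence is a short exact sequence which is pure exact and does not split
    Function.Injective finf ∧
    (∀ b : Binf, ginf b = 0 ↔ ∃ a : Ainf, finf a = b) ∧
    Function.Surjective ginf ∧
    (∀ c : Cinf, ∃ b : Binf, ginf b = c ∧ addOrderOf b = addOrderOf c) ∧
    (¬ ∃ s : Cinf →+ Binf, ∀ c : Cinf, ginf (s c) = c) ∧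
    Nonempty PureExactNonSplitSequence := by
  have uinj : ∀ n, 1 ≤ n → Function.Injective (u n) := fun n hn =>
    (injective_iff_map_eq_zero _).2 fun x hx =>
      let ⟨l, hl⟩ := huker n hn x hx
      (injective_iff_map_eq_zero _).1 (psiChain_injective p n l) x hl
  have vinj : ∀ n, 1 ≤ n → Function.Injective (v n) := fun n hn =>
    (injective_iff_map_eq_zero _).2 fun x hx =>
      let ⟨l, hl⟩ := hvker n hn x hx
      (injective_iff_map_eq_zero _).1 (etaChain_injective hp.ne_zero n l) x hl
  have hf : ∀ n, 1 ≤ n → ∀ x, finf (uA n x) = u n x := fun n hn x =>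
    DFunLike.congr_fun (hfinf n hn) x
  have hg : ∀ n, 1 ≤ n → ∀ x, ginf (u n x) = v n (gmap p n x) := fun n hn x =>
    DFunLike.congr_fun (hginf n hn) x
  have inj : Function.Injective finf := by
    rw [injective_iff_map_eq_zero]
    intro a ha
    obtain ⟨n, hn, x, rfl⟩ := huAsurj a
    rw [hf n hn, map_eq_zero_iff _ (uinj n hn)] at ha
    rw [show x = 0 from Subtype.ext ha, map_zero]
  have exact' : ∀ b : Binf, ginf b = 0 ↔ ∃ a : Ainf, finf a = b := by
    refine fun b => ⟨fun hb => ?_, ?_⟩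
    · obtain ⟨n, hn, x, rfl⟩ := husurj b
      rw [hg n hn, map_eq_zero_iff _ (vinj n hn)] at hb
      exact ⟨uA n ⟨x, hb⟩, hf n hn _⟩
    · rintro ⟨a, rfl⟩
      obtain ⟨n, hn, x, rfl⟩ := huAsurj a
      rw [hf n hn, hg n hn, AddMonoidHom.mem_ker.1 x.2, map_zero]
  have pure' : ∀ c : Cinf, ∃ b : Binf, ginf b = c ∧ addOrderOf b = addOrderOf c := by
    intro c
    obtain ⟨n, hn, c, rfl⟩ := hvsurj c
    obtain ⟨n, rfl⟩ := Nat.exists_eq_add_of_le' hn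
    refine ⟨u (n + 1) (Pi.single (Fin.last n) c), by rw [hg _ hn, gmap_single_last], ?_⟩
    rw [addOrderOf_injective _ (uinj _ hn), addOrderOf_injective _ (vinj _ hn)]
    exact addOrderOf_injective
      (AddMonoidHom.single (fun k : Fin (n + 1) => ZMod (p ^ (k.1 + 1))) (Fin.last n))
      (Pi.single_injective (M := fun k : Fin (n + 1) => ZMod (p ^ (k.1 + 1))) (Fin.last n)) c
  have surj : Function.Surjective ginf := fun c => (pure' c).imp fun _ h => h.1
  have nonsplit : ¬ ∃ s : Cinf →+ Binf, ∀ c : Cinf, ginf (s c) = c := by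
    rintro ⟨s, hs⟩
    have h0 : s (v 1 1) = 0 := eq_zero_of_forall_pow_dvd u hu husurj uinj _ fun k =>
      ⟨s (v (k + 1) 1), by rw [← map_nsmul, pow_nsmul_apply_one v hv]⟩
    have h1 : v 1 1 = 0 := by rw [← hs (v 1 1), h0, map_zero]
    rw [map_eq_zero_iff _ (vinj 1 le_rfl)] at h1
    have : Fact (1 < p ^ 1) := ⟨by simpa using hp.one_lt⟩
    exact one_ne_zero h1
  have : Small.{0} Ainf := small_of_surjective
    (f := fun x : Σ n, AddMonoidHom.ker (gmap p n) => uA x.1 x.2) fun a =>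
      let ⟨n, _, x, hx⟩ := huAsurj a
      ⟨⟨n, x⟩, hx⟩
  have : Small.{0} Binf := small_of_surjective
    (f := fun x : Σ n, Bgrp p n => u x.1 x.2) fun b =>
      let ⟨n, _, x, hx⟩ := husurj b
      ⟨⟨n, x⟩, hx⟩
  have : Small.{0} Cinf := small_of_surjective surj
  exact ⟨inj, exact', surj, pure', nonsplit,
    nonempty_pureExactNonSplitSequence finf ginf inj exact' surj pure' nonsplit⟩
end

section
/- Let p be a prime, let k be a field of characteristic 0, and let K/k be a Galois field extension such that K contains no nontrivial p-th root of unity (every x ∈ K with x^p = 1 satisfies x = 1). If u ∈ k is not a p-th power in k, then u is not a p-th power in K. -/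
/-- Let `p` be a prime, `k` a field of characteristic `0`, and `K/k` a Galois extension
containing no nontrivial `p`-th root of unity. If `u ∈ k` is not a `p`-th power in `k`,
then `u` is not a `p`-th power in `K`. -/
theorem not_pth_power_in_galois_extension
    (p : ℕ) (hp : p.Prime)
    (k K : Type*) [Field k] [Field K] [CharZero k] [Algebra k K] [IsGalois k K]
    (hroots : ∀ x : K, x ^ p = 1 → x = 1)
    (u : k) (hu : ¬ ∃ a : k, a ^ p = u) :
    ¬ ∃ α : K, α ^ p = algebraMap k K u := by
  rintro ⟨α, hα⟩
  have hfixed : ∀ σ : K ≃ₐ[k] K, σ α = α := by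
    intro σ
    have hσ : σ α ^ p = α ^ p := by rw [← map_pow, hα, σ.commutes]
    by_cases h0 : α = 0
    · simp [h0]
    · exact (div_eq_one_iff_eq h0).mp
        (hroots _ (by rw [div_pow, hσ, div_self (pow_ne_zero p h0)]))
  obtain ⟨a, rfl⟩ := (InfiniteGalois.mem_range_algebraMap_iff_fixed α).mpr hfixed
  exact hu ⟨a, (algebraMap k K).injective (by rw [map_pow, hα])⟩
end
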